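/- arXiv:2503.06570 — 3 statements merged into one kernel-verified Lean document; each statement's English description precedes it below -/
import Mathlib

section
/- Let r ≥ 1 be an integer, β ∈ ℂ with Re β > −1, T > 0, θ ∈ ℝ, L ∈ ℕ, and let (a_m) be a complex sequence admitting the asymptotic expansion a_m = (T^(r·m+β)·exp(iθ(r·m+β))/Γ(1 + r·m + β))·(∑_{ℓ=0}^{L} A_ℓ·m^(−ℓ) + ε_m) for some A_0, …, A_L ∈ ℂ and ε_m = o(m^(−L)) as m → ∞. Let φ ∈ ℝ with θ + φ ∈ (2π/r)·ℤ. Then there exist B_0, …, B_L ∈ ℂ with B_0 = A_0 such that, as s → +∞, ∑_{m=0}^∞ a_m·exp((r·m+β)(log s + iφ)) = e^(T·s)·( ∑_{ℓ=0}^{L} (1/r)·exp(i(θ+φ)·β)·B_ℓ·(T·s)^(−ℓ) + o(s^(−L)) ). -/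
/-- Complex power of a real number via the real logarithm:
`s ^ w := exp (w * log s)`. -/
noncomputable def cpowR (s : ℝ) (w : ℂ) : ℂ := Complex.exp (w * Real.log s)

open Filter Asymptotics MeasureTheory Topology

/-- The average of `exp (ω ^ k * u)` over the `r`-th roots of unity `ω ^ k`. -/
noncomputable def rootsExpMean (r : ℕ) (u : ℂ) : ℂ :=
  (r : ℂ)⁻¹ * ∑ k ∈ Finset.range r,
    Complex.exp (Complex.exp (2 * Real.pi * Complex.I / r) ^ k * u)

theorem continuous_rootsExpMean (r : ℕ) : Continuous (rootsExpMean r) := by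
  unfold rootsExpMean
  fun_prop

theorem hasSum_rootsExpMean {r : ℕ} (hr : 1 ≤ r) (u : ℂ) :
    HasSum (fun m : ℕ => u ^ (r * m) / ((r * m).factorial : ℂ)) (rootsExpMean r u) := by
  have hr0 : r ≠ 0 := by omega
  have hω := Complex.isPrimitiveRoot_exp r hr0
  unfold rootsExpMean
  set ω := Complex.exp (2 * Real.pi * Complex.I / r) with hωdef
  have h1 : HasSum (fun n : ℕ => (r : ℂ)⁻¹ * ∑ k ∈ Finset.range r, (ω ^ k * u) ^ n / (n.factorial : ℂ))
      ((r : ℂ)⁻¹ * ∑ k ∈ Finset.range r, Complex.exp (ω ^ k * u)) := by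
    refine (hasSum_sum fun k _ => ?_).mul_left _
    rw [Complex.exp_eq_exp_ℂ]
    exact NormedSpace.expSeries_div_hasSum_exp (ω ^ k * u)
  have hinj : Function.Injective (fun m : ℕ => r * m) := fun a b h =>
    Nat.eq_of_mul_eq_mul_left (by omega) h
  rw [← hinj.hasSum_iff] at h1
  · convert h1 using 2 with m
    have : ∀ k ∈ Finset.range r, (ω ^ k * u) ^ (r * m) / ((r * m).factorial : ℂ)
        = u ^ (r * m) / ((r * m).factorial : ℂ) := by
      intro k _
      rw [mul_pow, ← pow_mul, show k * (r * m) = r * (k * m) by ring, pow_mul, hω.pow_eq_one,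
        one_pow, one_mul]
    simp only [Function.comp]
    rw [Finset.sum_congr rfl this]
    have : (r : ℂ) ≠ 0 := by exact_mod_cast hr0
    simp
    field_simp
  · intro n hn
    have hdvd : ¬ r ∣ n := fun ⟨m, hm⟩ => hn ⟨m, hm.symm⟩
    have hne : ω ^ n ≠ 1 := fun h => hdvd ((hω.pow_eq_one_iff_dvd n).1 h)
    have hgeom : ∑ k ∈ Finset.range r, (ω ^ n) ^ k = 0 := by
      rw [geom_sum_eq hne, ← pow_mul, mul_comm n r, pow_mul, hω.pow_eq_one]
      simp
    have : ∑ k ∈ Finset.range r, (ω ^ k * u) ^ n / (n.factorial : ℂ)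
        = (∑ k ∈ Finset.range r, (ω ^ n) ^ k) * (u ^ n / n.factorial) := by
      rw [Finset.sum_mul]
      refine Finset.sum_congr rfl fun k _ => ?_
      rw [mul_pow, ← pow_mul, ← pow_mul, mul_comm k n]
      ring
    rw [this, hgeom]
    simp

theorem exists_norm_rootsExpMean_sub_le {r : ℕ} (hr : 1 ≤ r) :
    ∃ ρ : ℝ, 0 ≤ ρ ∧ ρ < 1 ∧ ∀ u : ℝ, 0 ≤ u →
      ‖rootsExpMean r u - Complex.exp u / r‖ ≤ Real.exp (ρ * u) := by
  have hr0 : r ≠ 0 := by omega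
  have hω := Complex.isPrimitiveRoot_exp r hr0
  set ω := Complex.exp (2 * Real.pi * Complex.I / r) with hωdef
  have hre : ∀ k ∈ Finset.Ico 1 r, (ω ^ k).re < 1 := by
    intro k hk
    rw [Finset.mem_Ico] at hk
    have hnorm : ‖ω ^ k‖ = 1 := by rw [norm_pow, hω.norm'_eq_one hr0, one_pow]
    refine lt_of_le_of_ne (hnorm ▸ Complex.re_le_norm _) fun h => ?_
    refine hω.pow_ne_one_of_pos_of_lt (by omega) hk.2 ?_
    have hsq := Complex.sq_norm (ω ^ k)
    rw [hnorm, Complex.normSq_apply, h] at hsq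
    exact Complex.ext h (by simpa using (by nlinarith : (ω ^ k).im * (ω ^ k).im = 0))
  set S : Finset ℝ := insert 0 ((Finset.Ico 1 r).image fun k => (ω ^ k).re) with hS
  have hSne : S.Nonempty := ⟨0, by simp [hS]⟩
  refine ⟨S.max' hSne, S.le_max' 0 (by simp [hS]), ?_, fun u hu => ?_⟩
  · rw [Finset.max'_lt_iff]
    intro y hy
    rw [hS, Finset.mem_insert, Finset.mem_image] at hy
    rcases hy with rfl | ⟨k, hk, rfl⟩
    · norm_num
    · exact hre k hk
  · have hsplit : rootsExpMean r u - Complex.exp u / r =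
        (r : ℂ)⁻¹ * ∑ k ∈ Finset.Ico 1 r, Complex.exp (ω ^ k * u) := by
      unfold rootsExpMean
      rw [← hωdef, Finset.range_eq_Ico, Finset.sum_eq_sum_Ico_succ_bot (by omega)]
      simp
      ring
    rw [hsplit, norm_mul, norm_inv, Complex.norm_natCast]
    have hb : ‖∑ k ∈ Finset.Ico 1 r, Complex.exp (ω ^ k * u)‖ ≤
        ∑ k ∈ Finset.Ico 1 r, Real.exp (S.max' hSne * u) := by
      refine norm_sum_le_of_le _ fun k hk => ?_
      rw [Complex.norm_exp, Complex.re_mul_ofReal]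
      gcongr
      exact S.le_max' _ (by rw [hS]; exact Finset.mem_insert_of_mem (Finset.mem_image_of_mem _ hk))
    rw [Finset.sum_const, Nat.card_Ico, nsmul_eq_mul] at hb
    have hrpos : (0 : ℝ) < r := by exact_mod_cast hr
    rw [inv_mul_le_iff₀ hrpos]
    refine hb.trans ?_
    gcongr
    exact Nat.sub_le _ _

/-- The general term of the series of Mittag-Leffler type `∑ x ^ (r m + γ) / Γ(1 + r m + γ)`. -/
noncomputable def mlTerm (r : ℕ) (γ : ℂ) (x : ℝ) (m : ℕ) : ℂ :=
  (x : ℂ) ^ ((r : ℂ) * m + γ) / Complex.Gamma (1 + (r : ℂ) * m + γ)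

theorem integral_cpow_mul_pow_div_factorial {r : ℕ} {γ : ℂ} (hγ : 0 < γ.re) {x : ℝ} (hx : 0 < x)
    (m : ℕ) :
    ∫ t in (0 : ℝ)..x, (t : ℂ) ^ (γ - 1) * (((x - t : ℝ) : ℂ) ^ (r * m) / ((r * m).factorial : ℂ)) =
      Complex.Gamma γ * mlTerm r γ x m := by
  have hn : 0 < (((r * m : ℕ) : ℂ) + 1).re := by
    simp only [Complex.add_re, Complex.natCast_re, Complex.one_re]
    positivity
  have h1 := Complex.betaIntegral_scaled γ (((r * m : ℕ) : ℂ) + 1) hx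
  have h2 := Complex.Gamma_mul_Gamma_eq_betaIntegral hγ hn
  have hG : Complex.Gamma (γ + (((r * m : ℕ) : ℂ) + 1)) ≠ 0 :=
    Complex.Gamma_ne_zero_of_re_pos (by rw [Complex.add_re]; linarith)
  rw [Complex.Gamma_nat_eq_factorial] at h2
  have hf : ((r * m).factorial : ℂ) ≠ 0 := by exact_mod_cast Nat.factorial_ne_zero _
  calc _ = ∫ t in (0 : ℝ)..x, ((r * m).factorial : ℂ)⁻¹ *
        ((t : ℂ) ^ (γ - 1) * ((x : ℂ) - t) ^ ((((r * m : ℕ) : ℂ) + 1) - 1)) := by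
        refine intervalIntegral.integral_congr fun t _ => ?_
        simp only [add_sub_cancel_right, Complex.cpow_natCast]
        push_cast
        ring
    _ = _ := by
        rw [intervalIntegral.integral_const_mul, h1, mlTerm]
        have e1 : 1 + (r : ℂ) * m + γ = γ + (((r * m : ℕ) : ℂ) + 1) := by push_cast; ring
        have e2 : γ + (((r * m : ℕ) : ℂ) + 1) - 1 = (r : ℂ) * m + γ := by push_cast; ring
        rw [e1, e2]
        field_simp
        linear_combination -(x : ℂ) ^ ((r : ℂ) * m + γ) * h2

theorem hasSum_mlTerm {r : ℕ} (hr : 1 ≤ r) {γ : ℂ} (hγ : 0 < γ.re) {x : ℝ} (hx : 0 < x) :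
    HasSum (mlTerm r γ x) ((Complex.Gamma γ)⁻¹ *
      ∫ t in (0 : ℝ)..x, (t : ℂ) ^ (γ - 1) * rootsExpMean r ((x - t : ℝ) : ℂ)) := by
  have hG : Complex.Gamma γ ≠ 0 := Complex.Gamma_ne_zero_of_re_pos hγ
  have hsum : Summable fun m : ℕ => x ^ (r * m) / ((r * m).factorial : ℝ) := by
    have := (hasSum_rootsExpMean hr (x : ℂ)).summable.norm
    refine this.congr fun m => ?_
    rw [norm_div, norm_pow, Complex.norm_real, Complex.norm_natCast, Real.norm_of_nonneg hx.le]
  have key : HasSum (fun m : ℕ => ∫ t in (0 : ℝ)..x, (t : ℂ) ^ (γ - 1) *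
      (((x - t : ℝ) : ℂ) ^ (r * m) / ((r * m).factorial : ℂ)))
      (∫ t in (0 : ℝ)..x, (t : ℂ) ^ (γ - 1) * rootsExpMean r ((x - t : ℝ) : ℂ)) := by
    refine intervalIntegral.hasSum_integral_of_dominated_convergence
      (fun m t => t ^ (γ.re - 1) * (x ^ (r * m) / ((r * m).factorial : ℝ))) ?_ ?_ ?_ ?_ ?_
    · intro m
      refine Measurable.aestronglyMeasurable ?_
      fun_prop
    · refine fun m => Eventually.of_forall fun t ht => ?_
      rw [Set.uIoc_of_le hx.le] at ht
      rw [norm_mul, norm_div, norm_pow, Complex.norm_natCast, Complex.norm_real,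
        Complex.norm_cpow_eq_rpow_re_of_pos ht.1, Real.norm_of_nonneg (sub_nonneg.2 ht.2)]
      simp only [Complex.sub_re, Complex.one_re]
      have := ht.1
      gcongr
      · linarith [ht.2]
      · linarith
    · exact Eventually.of_forall fun t _ => hsum.mul_left _
    · simp_rw [tsum_mul_left]
      exact (intervalIntegral.intervalIntegrable_rpow' (by linarith)).mul_const _
    · exact Eventually.of_forall fun t _ => (hasSum_rootsExpMean hr _).mul_left _
  simp_rw [integral_cpow_mul_pow_div_factorial hγ hx] at key
  simpa [← mul_assoc, inv_mul_cancel₀ hG] using key.mul_left (Complex.Gamma γ)⁻¹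

theorem exists_norm_integral_Ioi_Gamma_le {γ : ℂ} (hγ : 0 < γ.re) :
    ∃ C : ℝ, ∀ x : ℝ, 0 < x →
      ‖∫ t in Set.Ioi x, (Real.exp (-t) : ℂ) * (t : ℂ) ^ (γ - 1)‖ ≤ C * Real.exp (-(x / 2)) := by
  have hint : IntegrableOn (fun t : ℝ => t ^ (γ.re - 1) * Real.exp (-(1 / 2) * t)) (Set.Ioi 0) := by
    simpa using integrableOn_rpow_mul_exp_neg_mul_rpow (p := 1) (s := γ.re - 1) (b := 1 / 2)
      (by linarith) one_pos (by norm_num)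
  refine ⟨∫ t in Set.Ioi 0, t ^ (γ.re - 1) * Real.exp (-(1 / 2) * t), fun x hx => ?_⟩
  have hsub : Set.Ioi x ⊆ Set.Ioi 0 := Set.Ioi_subset_Ioi hx.le
  calc _ ≤ ∫ t in Set.Ioi x, t ^ (γ.re - 1) * Real.exp (-(1 / 2) * t) * Real.exp (-(x / 2)) := by
        refine norm_integral_le_of_norm_le ((hint.mono_set hsub).mul_const _) ?_
        refine (ae_restrict_iff' measurableSet_Ioi).2 (Eventually.of_forall fun t ht => ?_)
        have ht0 : 0 < t := hsub ht
        rw [norm_mul, Complex.norm_real, Real.norm_of_nonneg (Real.exp_pos _).le,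
          Complex.norm_cpow_eq_rpow_re_of_pos ht0, mul_assoc, ← Real.exp_add, mul_comm]
        simp only [Complex.sub_re, Complex.one_re]
        gcongr
        have : x < t := ht
        linarith
    _ ≤ _ := by
        rw [integral_mul_const]
        refine mul_le_mul_of_nonneg_right ?_ (Real.exp_pos _).le
        refine setIntegral_mono_set hint ?_ hsub.eventuallyLE
        refine (ae_restrict_iff' measurableSet_Ioi).2 (Eventually.of_forall fun t ht => ?_)
        have ht0 : (0 : ℝ) < t := ht
        simp only [Pi.zero_apply]
        positivity

theorem isLittleO_exp_mul_rpow {ρ : ℝ} (hρ : ρ < 1) (p : ℝ) (N : ℕ) :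
    (fun x : ℝ => Real.exp (ρ * x) * x ^ p) =o[atTop]
      fun x : ℝ => Real.exp x * (x ^ N)⁻¹ := by
  have h := isLittleO_rpow_exp_pos_mul_atTop (p + N) (sub_pos.2 hρ)
  have h2 := (isBigO_refl (fun x : ℝ => Real.exp (ρ * x) * (x ^ N)⁻¹) atTop).mul_isLittleO h
  refine h2.congr' ?_ ?_
  · filter_upwards [eventually_gt_atTop 0] with x hx
    rw [Real.rpow_add hx, Real.rpow_natCast]
    field_simp
  · refine Eventually.of_forall fun x => ?_
    dsimp only
    rw [mul_right_comm, ← Real.exp_add]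
    ring_nf

theorem tsum_mlTerm_sub_eq {r : ℕ} (hr : 1 ≤ r) {γ : ℂ} (hγ : 0 < γ.re) {x : ℝ} (hx : 0 < x) :
    (∑' m, mlTerm r γ x m) - Complex.exp x / r = (Complex.Gamma γ)⁻¹ *
      ((∫ t in (0 : ℝ)..x, (t : ℂ) ^ (γ - 1) *
          (rootsExpMean r ((x - t : ℝ) : ℂ) - Complex.exp ((x - t : ℝ) : ℂ) / r)) -
        Complex.exp x / r * ∫ t in Set.Ioi x, (Real.exp (-t) : ℂ) * (t : ℂ) ^ (γ - 1)) := by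
  have hG : Complex.Gamma γ ≠ 0 := Complex.Gamma_ne_zero_of_re_pos hγ
  have hpow : IntervalIntegrable (fun t : ℝ => (t : ℂ) ^ (γ - 1)) volume 0 x :=
    intervalIntegral.intervalIntegrable_cpow' (by simpa using hγ)
  have hcont : Continuous fun t : ℝ => rootsExpMean r ((x - t : ℝ) : ℂ) :=
    (continuous_rootsExpMean r).comp (by fun_prop)
  have hGint := Complex.GammaIntegral_convergent hγ
  have hGam := intervalIntegral.integral_interval_add_Ioi hGint
    (hGint.mono_set (Set.Ioi_subset_Ioi hx.le))
  have hΓ := Complex.Gamma_eq_integral hγ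
  rw [Complex.GammaIntegral] at hΓ
  rw [← hΓ] at hGam
  have hexp : ∫ t in (0 : ℝ)..x, (t : ℂ) ^ (γ - 1) * (Complex.exp ((x - t : ℝ) : ℂ) / r) =
      Complex.exp x / r * ∫ t in (0 : ℝ)..x, (Real.exp (-t) : ℂ) * (t : ℂ) ^ (γ - 1) := by
    rw [← intervalIntegral.integral_const_mul]
    refine intervalIntegral.integral_congr fun t _ => ?_
    push_cast
    rw [sub_eq_add_neg (x : ℂ), Complex.exp_add]
    ring
  simp_rw [mul_sub]
  rw [(hasSum_mlTerm hr hγ hx).tsum_eq, intervalIntegral.integral_sub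
    (hpow.mul_continuousOn hcont.continuousOn)
    (hpow.mul_continuousOn (Continuous.continuousOn (by fun_prop))), hexp]
  field_simp
  linear_combination (Complex.exp x / r) * hGam

theorem tsum_mlTerm_sub_isLittleO_of_pos {r : ℕ} (hr : 1 ≤ r) {γ : ℂ} (hγ : 0 < γ.re) (N : ℕ) :
    (fun x : ℝ => (∑' m, mlTerm r γ x m) - Complex.exp x / r) =o[atTop]
      fun x : ℝ => Real.exp x * (x ^ N)⁻¹ := by
  obtain ⟨ρ, hρ0, hρ, hle⟩ := exists_norm_rootsExpMean_sub_le hr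
  obtain ⟨C, hC⟩ := exists_norm_integral_Ioi_Gamma_le hγ
  have hlit := (((isLittleO_exp_mul_rpow hρ γ.re N).const_mul_left (γ.re)⁻¹).add
    ((isLittleO_exp_mul_rpow (by norm_num : (1 / 2 : ℝ) < 1) 0 N).const_mul_left C)).const_mul_left
      ‖(Complex.Gamma γ)⁻¹‖
  refine IsBigO.trans_isLittleO (IsBigO.of_bound' ?_) hlit
  filter_upwards [eventually_gt_atTop 0] with x hx
  refine le_trans ?_ (Real.le_norm_self _)
  rw [tsum_mlTerm_sub_eq hr hγ hx, norm_mul]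
  gcongr
  refine (norm_sub_le _ _).trans (add_le_add ?_ ?_)
  · have hint : IntervalIntegrable (fun t : ℝ => t ^ (γ.re - 1)) volume 0 x :=
      intervalIntegral.intervalIntegrable_rpow' (by linarith)
    have hb := intervalIntegral.norm_integral_le_of_norm_le (μ := volume)
      (f := fun t : ℝ => (t : ℂ) ^ (γ - 1) *
          (rootsExpMean r ((x - t : ℝ) : ℂ) - Complex.exp ((x - t : ℝ) : ℂ) / r))
      (g := fun t => t ^ (γ.re - 1) * Real.exp (ρ * x)) hx.le
      (Eventually.of_forall fun t ht => ?_) (hint.mul_const _)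
    · refine hb.trans (le_of_eq ?_)
      rw [intervalIntegral.integral_mul_const, integral_rpow (Or.inl (by linarith))]
      rw [sub_add_cancel, Real.zero_rpow hγ.ne']
      ring
    · rw [norm_mul, Complex.norm_cpow_eq_rpow_re_of_pos ht.1]
      simp only [Complex.sub_re, Complex.one_re]
      have := ht.1
      gcongr
      refine (hle (x - t) (sub_nonneg.2 ht.2)).trans ?_
      gcongr
      linarith
  · rw [norm_mul, norm_div, Complex.norm_natCast, Complex.norm_exp, Complex.ofReal_re,
      Real.rpow_zero, mul_one]
    have hr1 : (1 : ℝ) ≤ r := by exact_mod_cast hr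
    calc _ ≤ Real.exp x * (C * Real.exp (-(x / 2))) := by
          gcongr
          · exact div_le_self (Real.exp_pos _).le hr1
          · exact hC x hx
      _ = C * Real.exp (1 / 2 * x) := by
          rw [mul_left_comm, ← Real.exp_add]
          ring_nf

theorem norm_mlTerm {r : ℕ} {γ : ℂ} {x : ℝ} (hx : 0 < x) (m : ℕ) :
    ‖mlTerm r γ x m‖ = x ^ ((r : ℝ) * m + γ.re) / ‖Complex.Gamma (1 + (r : ℂ) * m + γ)‖ := by
  rw [mlTerm, norm_div, Complex.norm_cpow_eq_rpow_re_of_pos hx]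
  simp

theorem mlTerm_succ (r : ℕ) (γ : ℂ) (x : ℝ) (m : ℕ) :
    mlTerm r γ x (m + 1) = mlTerm r (γ + r) x m := by
  unfold mlTerm
  push_cast
  ring_nf

theorem mlTerm_isLittleO (r : ℕ) (γ : ℂ) (m N : ℕ) :
    (fun x : ℝ => mlTerm r γ x m) =o[atTop] fun x : ℝ => Real.exp x * (x ^ N)⁻¹ := by
  have h := (isLittleO_exp_mul_rpow zero_lt_one ((r : ℝ) * m + γ.re) N).const_mul_left
    ‖Complex.Gamma (1 + (r : ℂ) * m + γ)‖⁻¹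
  refine IsBigO.trans_isLittleO (IsBigO.of_bound' ?_) h
  filter_upwards [eventually_gt_atTop 0] with x hx
  refine le_trans (le_of_eq ?_) (Real.le_norm_self _)
  rw [norm_mlTerm hx, zero_mul, Real.exp_zero]
  ring

theorem summable_mlTerm {r : ℕ} (hr : 1 ≤ r) {γ : ℂ} (hγ : -1 < γ.re) {x : ℝ} (hx : 0 < x) :
    Summable (mlTerm r γ x) := by
  rw [← summable_nat_add_iff 1]
  simp_rw [mlTerm_succ]
  have hr1 : (1 : ℝ) ≤ r := by exact_mod_cast hr
  refine (hasSum_mlTerm hr ?_ hx).summable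
  rw [Complex.add_re, Complex.natCast_re]
  linarith

theorem tsum_mlTerm_sub_isLittleO {r : ℕ} (hr : 1 ≤ r) {γ : ℂ} (hγ : -1 < γ.re) (N : ℕ) :
    (fun x : ℝ => (∑' m, mlTerm r γ x m) - Complex.exp x / r) =o[atTop]
      fun x : ℝ => Real.exp x * (x ^ N)⁻¹ := by
  have hr1 : (1 : ℝ) ≤ r := by exact_mod_cast hr
  have hγr : 0 < (γ + r).re := by
    rw [Complex.add_re, Complex.natCast_re]
    linarith
  refine ((mlTerm_isLittleO r γ 0 N).add (tsum_mlTerm_sub_isLittleO_of_pos hr hγr N)).congr' ?_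
    EventuallyEq.rfl
  filter_upwards [eventually_gt_atTop 0] with x hx
  rw [(summable_mlTerm hr hγ hx).tsum_eq_zero_add]
  simp_rw [mlTerm_succ]
  ring

theorem Gamma_mul_norm_Gamma_le {β : ℂ} (hβ : -1 < β.re) (n : ℕ) :
    Real.Gamma (1 + n + β.re) * ‖Complex.Gamma (1 + β)‖ ≤
      Real.Gamma (1 + β.re) * ‖Complex.Gamma (1 + n + β)‖ := by
  induction n with
  | zero => simp
  | succ n ih =>
    have hpos : 0 < 1 + (n : ℝ) + β.re := by
      have : (0 : ℝ) ≤ n := n.cast_nonneg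
      linarith
    have hre : (1 + (n : ℂ) + β).re = 1 + (n : ℝ) + β.re := by simp
    have hne : 1 + (n : ℂ) + β ≠ 0 := fun h => by
      rw [h, Complex.zero_re] at hre
      linarith
    have e1 : 1 + ((n + 1 : ℕ) : ℝ) + β.re = (1 + n + β.re) + 1 := by push_cast; ring
    have e2 : 1 + ((n + 1 : ℕ) : ℂ) + β = (1 + n + β) + 1 := by push_cast; ring
    rw [e1, e2, Real.Gamma_add_one hpos.ne', Complex.Gamma_add_one _ hne, norm_mul]
    have hle : 1 + (n : ℝ) + β.re ≤ ‖1 + (n : ℂ) + β‖ := hre ▸ Complex.re_le_norm _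
    calc _ = (1 + n + β.re) * (Real.Gamma (1 + n + β.re) * ‖Complex.Gamma (1 + β)‖) := by ring
      _ ≤ ‖1 + (n : ℂ) + β‖ * (Real.Gamma (1 + β.re) * ‖Complex.Gamma (1 + n + β)‖) := by
          have := Real.Gamma_pos_of_pos hpos
          gcongr
      _ = _ := by ring

theorem mlTerm_ofReal {r : ℕ} {σ x : ℝ} (hx : 0 < x) (m : ℕ) :
    mlTerm r (σ : ℂ) x m = ((x ^ ((r : ℝ) * m + σ) / Real.Gamma (1 + (r : ℝ) * m + σ) : ℝ) : ℂ) := by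
  rw [mlTerm, Complex.ofReal_div, Complex.ofReal_cpow hx.le, ← Complex.Gamma_ofReal]
  push_cast
  rfl

theorem exists_norm_mlTerm_le (r : ℕ) {β : ℂ} (hβ : -1 < β.re) :
    ∃ C : ℝ, 0 ≤ C ∧ ∀ (x : ℝ) (m : ℕ), 0 < x →
      ‖mlTerm r β x m‖ ≤ C * ‖mlTerm r (β.re : ℂ) x m‖ := by
  have h0 : 0 < ‖Complex.Gamma (1 + β)‖ := norm_pos_iff.2 <|
    Complex.Gamma_ne_zero_of_re_pos (by rw [Complex.add_re, Complex.one_re]; linarith)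
  have hG : 0 < Real.Gamma (1 + β.re) := Real.Gamma_pos_of_pos (by linarith)
  refine ⟨Real.Gamma (1 + β.re) / ‖Complex.Gamma (1 + β)‖, by positivity, fun x m hx => ?_⟩
  have hpos : 0 < 1 + (r : ℝ) * m + β.re := by
    have : (0 : ℝ) ≤ (r : ℝ) * m := by positivity
    linarith
  have h1 : 0 < Real.Gamma (1 + (r : ℝ) * m + β.re) := Real.Gamma_pos_of_pos hpos
  have h2 : 0 < ‖Complex.Gamma (1 + (r : ℂ) * m + β)‖ := norm_pos_iff.2 <|
    Complex.Gamma_ne_zero_of_re_pos (by simpa using hpos)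
  have key := Gamma_mul_norm_Gamma_le hβ (r * m)
  push_cast at key
  rw [norm_mlTerm hx, mlTerm_ofReal hx, Complex.norm_real, Real.norm_of_nonneg (by positivity),
    div_mul_div_comm, div_le_div_iff₀ h2 (by positivity)]
  have := mul_le_mul_of_nonneg_left key (Real.rpow_pos_of_pos hx ((r : ℝ) * m + β.re)).le
  linarith

theorem exists_tsum_norm_mlTerm_le {r : ℕ} (hr : 1 ≤ r) {β : ℂ} (hβ : -1 < β.re) :
    ∃ K : ℝ, 0 < K ∧ ∀ᶠ x : ℝ in atTop, ∑' m, ‖mlTerm r β x m‖ ≤ K * Real.exp x := by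
  obtain ⟨C, hC0, hC⟩ := exists_norm_mlTerm_le r hβ
  have hσ : -1 < ((β.re : ℝ) : ℂ).re := by simpa using hβ
  refine ⟨C * 2 + 1, by positivity, ?_⟩
  filter_upwards [(tsum_mlTerm_sub_isLittleO hr hσ 0).def one_pos, eventually_gt_atTop 0]
    with x hx hx0
  have hs := (summable_mlTerm hr hσ hx0).norm
  have hr1 : (1 : ℝ) ≤ r := by exact_mod_cast hr
  have h1 : ∑' m, ‖mlTerm r β x m‖ ≤ C * ∑' m, ‖mlTerm r (β.re : ℂ) x m‖ := by
    rw [← tsum_mul_left]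
    exact (summable_mlTerm hr hβ hx0).norm.tsum_le_tsum (fun m => hC x m hx0) (hs.mul_left C)
  have h2 : ∑' m, ‖mlTerm r (β.re : ℂ) x m‖ = ‖∑' m, mlTerm r (β.re : ℂ) x m‖ := by
    have hnn : ∀ m : ℕ, 0 ≤ x ^ ((r : ℝ) * m + β.re) / Real.Gamma (1 + (r : ℝ) * m + β.re) := by
      intro m
      have : (0 : ℝ) ≤ (r : ℝ) * m := by positivity
      have := Real.Gamma_pos_of_pos (show 0 < 1 + (r : ℝ) * m + β.re by linarith)
      positivity
    simp_rw [mlTerm_ofReal hx0, Complex.norm_real, ← Complex.ofReal_tsum, Complex.norm_real]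
    rw [Real.norm_of_nonneg (tsum_nonneg hnn)]
    exact tsum_congr fun m => Real.norm_of_nonneg (hnn m)
  have h3 : ‖∑' m, mlTerm r (β.re : ℂ) x m‖ ≤ 2 * Real.exp x := by
    have h4 : ‖Complex.exp x / (r : ℂ)‖ ≤ Real.exp x := by
      rw [norm_div, Complex.norm_natCast, Complex.norm_exp, Complex.ofReal_re]
      exact div_le_self (Real.exp_pos _).le hr1
    have h5 := norm_le_norm_add_norm_sub' (∑' m, mlTerm r (β.re : ℂ) x m) (Complex.exp x / (r : ℂ))
    simp only [pow_zero, inv_one, mul_one, one_mul, Real.norm_of_nonneg (Real.exp_pos x).le] at hx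
    linarith
  rw [h2] at h1
  nlinarith [Real.exp_pos x, mul_le_mul_of_nonneg_left h3 hC0]

theorem summable_mlTerm_mul {r : ℕ} (hr : 1 ≤ r) {β : ℂ} (hβ : -1 < β.re) {c : ℕ → ℂ} {D : ℝ}
    (hc : ∀ m, ‖c m‖ ≤ D) {x : ℝ} (hx : 0 < x) : Summable fun m => mlTerm r β x m * c m := by
  refine Summable.of_norm_bounded ((summable_mlTerm hr hβ hx).norm.mul_right D) fun m => ?_
  rw [norm_mul]
  gcongr
  exact hc m

theorem tsum_mlTerm_mul_isLittleO {r : ℕ} (hr : 1 ≤ r) {β : ℂ} (hβ : -1 < β.re) {δ : ℕ → ℂ}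
    (hδ : Tendsto δ atTop (𝓝 0)) :
    (fun x : ℝ => ∑' m, mlTerm r β x m * δ m) =o[atTop] fun x : ℝ => Real.exp x := by
  obtain ⟨K, hK0, hK⟩ := exists_tsum_norm_mlTerm_le hr hβ
  obtain ⟨D, hD⟩ : ∃ D, ∀ m, ‖δ m‖ ≤ D := by
    obtain ⟨D, hD⟩ := (Metric.isBounded_range_of_tendsto δ hδ).exists_norm_le
    exact ⟨D, fun m => hD _ ⟨m, rfl⟩⟩
  rw [isLittleO_iff]
  intro c hc
  have hη : 0 < c / (2 * K) := by positivity
  obtain ⟨M, hM⟩ := eventually_atTop.1 (hδ.norm.eventually_lt_const (by simpa using hη))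
  have hfin : (fun x : ℝ => ∑ m ∈ Finset.range M, mlTerm r β x m * δ m) =o[atTop]
      fun x : ℝ => Real.exp x := by
    refine IsLittleO.fun_sum fun m _ => ?_
    simpa [mul_comm] using (mlTerm_isLittleO r β m 0).const_mul_left (δ m)
  filter_upwards [hK, hfin.def (half_pos hc), eventually_gt_atTop 0] with x hKx hfx hx
  have hs := summable_mlTerm_mul hr hβ hD hx
  have hn := (summable_mlTerm hr hβ hx).norm
  have hn' := (summable_nat_add_iff M).2 hn
  rw [← hs.sum_add_tsum_nat_add M]
  have htail : ‖∑' m, mlTerm r β x (m + M) * δ (m + M)‖ ≤ c / 2 * Real.exp x := by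
    calc _ ≤ ∑' m, ‖mlTerm r β x (m + M)‖ * (c / (2 * K)) := by
          refine tsum_of_norm_bounded (hn'.mul_right _).hasSum fun m => ?_
          rw [norm_mul]
          gcongr
          exact (hM _ (by omega)).le
      _ ≤ (∑' m, ‖mlTerm r β x m‖) * (c / (2 * K)) := by
          rw [tsum_mul_right]
          refine mul_le_mul_of_nonneg_right ?_ hη.le
          rw [← hn.sum_add_tsum_nat_add M]
          exact le_add_of_nonneg_left (Finset.sum_nonneg fun _ _ => norm_nonneg _)
      _ ≤ (K * Real.exp x) * (c / (2 * K)) := by gcongr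
      _ = _ := by field_simp
  rw [Real.norm_of_nonneg (Real.exp_pos x).le] at hfx ⊢
  refine (norm_add_le _ _).trans ?_
  linarith

theorem tendsto_of_sub_sum_isLittleO {L : ℕ} {c A : ℕ → ℂ}
    (h : (fun m : ℕ => c m - ∑ l ∈ Finset.range (L + 1), A l * ((m : ℂ) ^ l)⁻¹) =o[atTop]
      fun m : ℕ => ((m : ℝ) ^ L)⁻¹) : Tendsto c atTop (𝓝 (A 0)) := by
  have h1 : Tendsto (fun m : ℕ => c m - ∑ l ∈ Finset.range (L + 1), A l * ((m : ℂ) ^ l)⁻¹)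
      atTop (𝓝 0) := by
    rw [← isLittleO_one_iff ℝ]
    refine h.trans_isBigO (IsBigO.of_bound' ?_)
    filter_upwards [eventually_ge_atTop 1] with m hm
    have hm1 : (1 : ℝ) ≤ m := by exact_mod_cast hm
    rw [norm_one, Real.norm_of_nonneg (by positivity)]
    exact inv_le_one_of_one_le₀ (one_le_pow₀ hm1)
  have h2 : Tendsto (fun m : ℕ => ∑ l ∈ Finset.range (L + 1), A l * ((m : ℂ) ^ l)⁻¹)
      atTop (𝓝 (A 0)) := by
    simp_rw [Finset.sum_range_succ']
    have : Tendsto (fun m : ℕ => ∑ l ∈ Finset.range L, A (l + 1) * ((m : ℂ) ^ (l + 1))⁻¹)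
        atTop (𝓝 (∑ l ∈ Finset.range L, A (l + 1) * 0)) := by
      refine tendsto_finsetSum _ fun l _ => Tendsto.const_mul _ ?_
      have h3 := (tendsto_inv_atTop_nhds_zero_nat (𝕜 := ℂ)).pow (l + 1)
      simpa [← inv_pow] using h3
    simpa using this.add_const (A 0 * (1 : ℂ)⁻¹)
  simpa using h1.add h2

theorem shift_sub_sum_isLittleO (r : ℕ) (β : ℂ) {L : ℕ} {c A : ℕ → ℂ}
    (h : (fun m : ℕ => c m - ∑ l ∈ Finset.range (L + 2), A l * ((m : ℂ) ^ l)⁻¹) =o[atTop]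
      fun m : ℕ => ((m : ℝ) ^ (L + 1))⁻¹) :
    (fun m : ℕ => ((r : ℂ) * m + β + 1) * (c m - A 0) - ∑ l ∈ Finset.range (L + 1),
        (r * A (l + 1) + (β + 1) * if l = 0 then 0 else A l) * ((m : ℂ) ^ l)⁻¹) =o[atTop]
      fun m : ℕ => ((m : ℝ) ^ L)⁻¹ := by
  have hone : (fun _ : ℕ => (1 : ℝ)) =o[atTop] fun m : ℕ => (m : ℝ) :=
    (isLittleO_const_left.2 <| Or.inr <| by
      simpa [Function.comp_def] using tendsto_natCast_atTop_atTop (R := ℝ))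
  have hlin : (fun m : ℕ => (r : ℂ) * m + β + 1) =O[atTop] fun m : ℕ => (m : ℝ) := by
    have hm : (fun m : ℕ => (m : ℂ)) =O[atTop] fun m : ℕ => (m : ℝ) :=
      IsBigO.of_bound' (Eventually.of_forall fun m => by simp)
    have hc : (fun _ : ℕ => β + 1) =O[atTop] fun m : ℕ => (m : ℝ) :=
      (isBigO_const_const _ one_ne_zero _).trans hone.isBigO
    simpa [add_assoc] using (hm.const_mul_left (r : ℂ)).add hc
  have hinv : (fun m : ℕ => ((m : ℝ)) * ((m : ℝ) ^ (L + 1))⁻¹) =ᶠ[atTop]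
      fun m : ℕ => ((m : ℝ) ^ L)⁻¹ := by
    filter_upwards [eventually_ge_atTop 1] with m hm
    have : (m : ℝ) ≠ 0 := by exact_mod_cast (by omega : m ≠ 0)
    field_simp
    rw [pow_succ']
  have h1 := (hlin.mul_isLittleO h).congr' EventuallyEq.rfl hinv
  have h2 : (fun m : ℕ => (β + 1) * A (L + 1) * ((m : ℂ) ^ (L + 1))⁻¹) =o[atTop]
      fun m : ℕ => ((m : ℝ) ^ L)⁻¹ := by
    refine IsLittleO.const_mul_left ?_ _
    have h3 : (fun m : ℕ => ((m : ℂ) ^ (L + 1))⁻¹) =O[atTop]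
        fun m : ℕ => (1 : ℝ) * ((m : ℝ) ^ (L + 1))⁻¹ :=
      IsBigO.of_bound' (Eventually.of_forall fun m => by simp)
    exact h3.trans_isLittleO
      ((hone.mul_isBigO (isBigO_refl _ _)).congr' EventuallyEq.rfl hinv)
  refine (h1.add h2).congr' ?_ EventuallyEq.rfl
  filter_upwards [eventually_ge_atTop 1] with m hm
  have hm0 : (m : ℂ) ≠ 0 := by exact_mod_cast (by omega : m ≠ 0)
  have hA' : ∑ l ∈ Finset.range (L + 1),
        (r * A (l + 1) + (β + 1) * if l = 0 then 0 else A l) * ((m : ℂ) ^ l)⁻¹ =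
      r * ∑ l ∈ Finset.range (L + 1), A (l + 1) * ((m : ℂ) ^ l)⁻¹ +
        (β + 1) * ∑ l ∈ Finset.range L, A (l + 1) * ((m : ℂ) ^ (l + 1))⁻¹ := by
    simp_rw [add_mul, Finset.sum_add_distrib, mul_assoc, ← Finset.mul_sum]
    rw [Finset.sum_range_succ' (fun l => (if l = 0 then 0 else A l) * ((m : ℂ) ^ l)⁻¹) L]
    simp
  have hQ : ∑ l ∈ Finset.range (L + 1), A (l + 1) * ((m : ℂ) ^ l)⁻¹ =
      m * ∑ l ∈ Finset.range (L + 1), A (l + 1) * ((m : ℂ) ^ (l + 1))⁻¹ := by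
    rw [Finset.mul_sum]
    refine Finset.sum_congr rfl fun l _ => ?_
    field_simp
    ring
  rw [hA', hQ, Finset.sum_range_succ' _ (L + 1), Finset.sum_range_succ _ L]
  simp only [pow_zero, inv_one, mul_one]
  ring

theorem mlTerm_eq_inv_mul {r : ℕ} {β : ℂ} (hβ : -1 < β.re) {x : ℝ} (hx : 0 < x) (m : ℕ) :
    mlTerm r β x m = (x : ℂ)⁻¹ * (mlTerm r (β + 1) x m * ((r : ℂ) * m + β + 1)) := by
  have hre : 0 < (1 + (r : ℂ) * m + β).re := by
    have : (0 : ℝ) ≤ (r : ℝ) * m := by positivity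
    simp
    linarith
  have hx0 : (x : ℂ) ≠ 0 := by exact_mod_cast hx.ne'
  have hne : 1 + (r : ℂ) * m + β ≠ 0 := fun h => by simp [h] at hre
  have hG := Complex.Gamma_ne_zero_of_re_pos hre
  unfold mlTerm
  rw [← add_assoc, ← add_assoc, Complex.Gamma_add_one _ hne,
    Complex.cpow_add _ 1 hx0, Complex.cpow_one]
  rw [show (r : ℂ) * m + β + 1 = 1 + (r : ℂ) * m + β by ring]
  field_simp

theorem exists_tsum_mlTerm_mul_expansion {r : ℕ} (hr : 1 ≤ r) (L : ℕ) :
    ∀ (β : ℂ) (_ : -1 < β.re) (c A : ℕ → ℂ)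
      (_ : (fun m : ℕ => c m - ∑ l ∈ Finset.range (L + 1), A l * ((m : ℂ) ^ l)⁻¹) =o[atTop]
        fun m : ℕ => ((m : ℝ) ^ L)⁻¹),
      ∃ B : ℕ → ℂ, B 0 = A 0 ∧
        (fun x : ℝ => (∑' m, mlTerm r β x m * c m) -
          Complex.exp x * ∑ l ∈ Finset.range (L + 1), 1 / (r : ℂ) * B l * ((x : ℂ) ^ l)⁻¹)
        =o[atTop] fun x : ℝ => Real.exp x * (x ^ L)⁻¹ := by
  induction L with
  | zero =>
    intro β hβ c A h
    have hδ : Tendsto (fun m => c m - A 0) atTop (𝓝 0) := by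
      simpa using (tendsto_of_sub_sum_isLittleO h).sub_const (A 0)
    obtain ⟨D, hD⟩ := (Metric.isBounded_range_of_tendsto _ hδ).exists_norm_le
    refine ⟨A, rfl, ?_⟩
    refine (((tsum_mlTerm_sub_isLittleO hr hβ 0).const_mul_left (A 0)).add
      (by simpa using tsum_mlTerm_mul_isLittleO hr hβ hδ)).congr' ?_ EventuallyEq.rfl
    filter_upwards [eventually_gt_atTop 0] with x hx
    have hs := summable_mlTerm_mul hr hβ (fun m => hD _ ⟨m, rfl⟩) hx
    have hsplit : ∑' m, mlTerm r β x m * c m =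
        A 0 * ∑' m, mlTerm r β x m + ∑' m, mlTerm r β x m * (c m - A 0) := by
      rw [← tsum_mul_left, ← ((summable_mlTerm hr hβ hx).mul_left (A 0)).tsum_add hs]
      exact tsum_congr fun m => by ring
    rw [hsplit]
    simp
    ring
  | succ L ih =>
    intro β hβ c A h
    have hβ' : -1 < (β + 1).re := by
      rw [Complex.add_re, Complex.one_re]
      linarith
    have hd := shift_sub_sum_isLittleO r β h
    obtain ⟨B, -, hB⟩ := ih (β + 1) hβ' _ _ hd
    obtain ⟨D, hD⟩ := (Metric.isBounded_range_of_tendsto _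
      (tendsto_of_sub_sum_isLittleO hd)).exists_norm_le
    refine ⟨fun l => Nat.casesOn l (A 0) B, rfl, ?_⟩
    have hinv : (fun x : ℝ => (x : ℂ)⁻¹) =O[atTop] fun x : ℝ => x⁻¹ :=
      IsBigO.of_bound' (Eventually.of_forall fun x => by simp)
    have h2 := (hinv.mul_isLittleO hB).congr_right
      (g₂ := fun x : ℝ => Real.exp x * (x ^ (L + 1))⁻¹) fun x => by
        rw [pow_succ, mul_inv]
        ring
    refine (((tsum_mlTerm_sub_isLittleO hr hβ (L + 1)).const_mul_left (A 0)).add h2).congr' ?_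
      EventuallyEq.rfl
    filter_upwards [eventually_gt_atTop 0] with x hx
    have hs := summable_mlTerm_mul hr hβ' (fun m => hD _ ⟨m, rfl⟩) hx
    have hsplit : ∑' m, mlTerm r β x m * c m = A 0 * ∑' m, mlTerm r β x m +
        (x : ℂ)⁻¹ * ∑' m, mlTerm r (β + 1) x m * (((r : ℂ) * m + β + 1) * (c m - A 0)) := by
      rw [← tsum_mul_left, ← tsum_mul_left,
        ← ((summable_mlTerm hr hβ hx).mul_left (A 0)).tsum_add (hs.mul_left _)]
      refine tsum_congr fun m => ?_
      linear_combination (c m - A 0) * mlTerm_eq_inv_mul (r := r) hβ hx m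
    have hsum : ∑ l ∈ Finset.range (L + 1), 1 / (r : ℂ) * B l * ((x : ℂ) ^ (l + 1))⁻¹ =
        (x : ℂ)⁻¹ * ∑ l ∈ Finset.range (L + 1), 1 / (r : ℂ) * B l * ((x : ℂ) ^ l)⁻¹ := by
      rw [Finset.mul_sum]
      refine Finset.sum_congr rfl fun l _ => ?_
      rw [pow_succ, mul_inv]
      ring
    rw [hsplit, Finset.sum_range_succ' _ (L + 1)]
    simp only [Nat.rec_zero, pow_zero, inv_one, mul_one]
    rw [hsum]
    ring

theorem stmt9 (r : ℕ) (hr : 1 ≤ r) (β : ℂ) (hβ : -1 < β.re)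
    (T : ℝ) (hT : 0 < T) (θ : ℝ) (L : ℕ) (a : ℕ → ℂ) (A : ℕ → ℂ) (ε : ℕ → ℂ)
    (hε : (fun m : ℕ => ε m) =o[Filter.atTop] fun m : ℕ => (((m : ℝ)) ^ L)⁻¹)
    (ha : ∀ m : ℕ, a m =
      cpowR T ((r : ℂ) * m + β) * Complex.exp (Complex.I * (θ : ℂ) * ((r : ℂ) * m + β)) /
          Complex.Gamma (1 + (r : ℂ) * m + β) *
        ((∑ l ∈ Finset.range (L + 1), A l * (((m : ℂ)) ^ l)⁻¹) + ε m))
    (φ : ℝ) (k : ℤ) (hk : θ + φ = 2 * Real.pi * k / r) :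
    ∃ B : ℕ → ℂ, B 0 = A 0 ∧
      (fun s : ℝ =>
        (∑' m : ℕ, a m * Complex.exp (((r : ℂ) * m + β) * ((Real.log s : ℂ) + φ * Complex.I))) -
          Complex.exp ((T * s : ℝ) : ℂ) *
            ∑ l ∈ Finset.range (L + 1),
              (1 / (r : ℂ)) * Complex.exp (Complex.I * ((θ : ℂ) + φ) * β) * B l *
                ((((T * s : ℝ) : ℂ)) ^ l)⁻¹)
        =o[Filter.atTop] fun s : ℝ => Real.exp (T * s) * (s ^ L)⁻¹ := by
  obtain ⟨B, hB0, hB⟩ := exists_tsum_mlTerm_mul_expansion hr L β hβ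
    (fun m => (∑ l ∈ Finset.range (L + 1), A l * ((m : ℂ) ^ l)⁻¹) + ε m) A
    (by simpa using hε)
  refine ⟨B, hB0, ?_⟩
  have hTs : Tendsto (fun s : ℝ => T * s) atTop atTop := tendsto_id.const_mul_atTop hT
  have hcomp := (hB.comp_tendsto hTs).const_mul_left (Complex.exp (Complex.I * ((θ : ℂ) + φ) * β))
  have hscale : ((fun x : ℝ => Real.exp x * (x ^ L)⁻¹) ∘ fun s : ℝ => T * s) =O[atTop]
      fun s : ℝ => Real.exp (T * s) * (s ^ L)⁻¹ := by
    refine ((isBigO_refl (fun s : ℝ => Real.exp (T * s) * (s ^ L)⁻¹) atTop).const_mul_left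
      (T ^ L)⁻¹).congr_left fun s => ?_
    simp only [Function.comp, mul_pow, mul_inv]
    ring
  refine (hcomp.trans_isBigO hscale).congr' ?_ EventuallyEq.rfl
  filter_upwards [eventually_gt_atTop 0] with s hs
  have hr0 : (r : ℂ) ≠ 0 := by exact_mod_cast (by omega : r ≠ 0)
  have hkC : (θ : ℂ) + φ = 2 * Real.pi * k / r := by exact_mod_cast congrArg Complex.ofReal hk
  have hterm : ∀ m : ℕ, a m * Complex.exp (((r : ℂ) * m + β) * ((Real.log s : ℂ) + φ * Complex.I)) =
      Complex.exp (Complex.I * ((θ : ℂ) + φ) * β) * (mlTerm r β (T * s) m *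
        ((∑ l ∈ Finset.range (L + 1), A l * ((m : ℂ) ^ l)⁻¹) + ε m)) := by
    intro m
    have hTs0 : ((T * s : ℝ) : ℂ) ≠ 0 := by exact_mod_cast (mul_pos hT hs).ne'
    have hexp : Complex.exp (((r : ℂ) * m + β) * Real.log T) *
        Complex.exp (Complex.I * (θ : ℂ) * ((r : ℂ) * m + β)) *
        Complex.exp (((r : ℂ) * m + β) * ((Real.log s : ℂ) + φ * Complex.I)) =
        Complex.exp (Complex.I * ((θ : ℂ) + φ) * β) *
          ((T * s : ℝ) : ℂ) ^ ((r : ℂ) * m + β) := by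
      rw [Complex.cpow_def_of_ne_zero hTs0, ← Complex.ofReal_log (mul_pos hT hs).le,
        Real.log_mul hT.ne' hs.ne', ← Complex.exp_add, ← Complex.exp_add, ← Complex.exp_add,
        Complex.exp_eq_exp_iff_exists_int]
      refine ⟨k * m, ?_⟩
      have hkr : ((θ : ℂ) + φ) * r = 2 * Real.pi * k := by
        rw [hkC]
        field_simp
      push_cast
      linear_combination Complex.I * m * hkr
    rw [ha m, mlTerm, cpowR]
    linear_combination (Complex.Gamma (1 + (r : ℂ) * m + β))⁻¹ *
      ((∑ l ∈ Finset.range (L + 1), A l * ((m : ℂ) ^ l)⁻¹) + ε m) * hexp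
  simp_rw [hterm]
  rw [tsum_mul_left]
  simp only [Function.comp]
  rw [mul_sub, mul_left_comm, Finset.mul_sum]
  congr 3
  exact funext fun l => by ring
end

section
/- Let r_X, r_Y ≥ 1 be integers and r := gcd(r_X, r_Y). Let β_X, β_Y ∈ ℂ with Re β_X > 0 and Re β_Y > 0, let T_X, T_Y > 0 and A_X, A_Y ∈ ℂ. Suppose the complex sequence (a_m) is (T_X, A_X)-scaled aML with respect to (r_X, β_X) and the complex sequence (b_m) is (T_Y, A_Y)-scaled aML with respect to (r_Y, β_Y). Define the Cauchy-type product coefficients c_m := ∑ a_{m_X}·b_{m_Y}, the sum ranging over all pairs (m_X, m_Y) ∈ ℕ² with r_X·m_X + r_Y·m_Y = r·m. Then (c_m) is (T_X + T_Y, (r/(r_X·r_Y))·A_X·A_Y)-scaled aML with respect to (r, β_X + β_Y). -/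
/-- A complex sequence `a` is `(T, θ, A)`-scaled asymptotically Mittag-Leffler
with respect to `(r, β)` if
`a m * Γ(1 + r·m + β) / (T^(r·m+β) · exp(i·θ·(r·m+β))) → A` as `m → ∞`. -/
def IsAML (r : ℕ) (β : ℂ) (a : ℕ → ℂ) (T θ : ℝ) (A : ℂ) : Prop :=
  Filter.Tendsto
    (fun m : ℕ => a m * Complex.Gamma (1 + (r : ℂ) * m + β) /
      (cpowR T ((r : ℂ) * m + β) * Complex.exp (Complex.I * (θ : ℂ) * ((r : ℂ) * m + β))))
    Filter.atTop (nhds A)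

open Filter Topology Finset

/-! ### Real-base complex powers -/

lemma cpowR_ne_zero (s : ℝ) (w : ℂ) : cpowR s w ≠ 0 := Complex.exp_ne_zero _

lemma cpowR_add (s : ℝ) (w z : ℂ) : cpowR s (w + z) = cpowR s w * cpowR s z := by
  simp only [cpowR, add_mul, Complex.exp_add]

lemma cpowR_mul {s t : ℝ} (hs : 0 < s) (ht : 0 < t) (w : ℂ) :
    cpowR (s * t) w = cpowR s w * cpowR t w := by
  simp only [cpowR, Real.log_mul hs.ne' ht.ne', Complex.ofReal_add, mul_add, Complex.exp_add]

lemma cpowR_div {s t : ℝ} (hs : 0 < s) (ht : 0 < t) (w : ℂ) :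
    cpowR (s / t) w = cpowR s w / cpowR t w := by
  simp only [cpowR, Real.log_div hs.ne' ht.ne', Complex.ofReal_sub, mul_sub, Complex.exp_sub]

lemma cpowR_natCast {s : ℝ} (hs : 0 < s) (n : ℕ) : cpowR s n = (s : ℂ) ^ n := by
  rw [cpowR, Complex.exp_nat_mul, ← Complex.ofReal_exp, Real.exp_log hs]

lemma cpowR_one_left (w : ℂ) : cpowR 1 w = 1 := by simp [cpowR]

lemma norm_cpowR {s : ℝ} (hs : 0 < s) (w : ℂ) : ‖cpowR s w‖ = s ^ w.re := by
  simp [cpowR, Complex.norm_exp, Real.rpow_def_of_pos hs, mul_comm]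

lemma continuousAt_cpowR {s : ℝ} (hs : 0 < s) (w : ℂ) : ContinuousAt (cpowR · w) s := by
  have h := Real.continuousAt_log hs.ne'
  unfold cpowR
  fun_prop

/-! ### The ratio of `Γ(1 + n + β)` to `n! (n + 1) ^ β` -/

/-- The ratio `(n + 1) ^ β * n! / Γ(1 + n + β)`. -/
noncomputable def gammaRatio (β : ℂ) (n : ℕ) : ℂ :=
  cpowR (n + 1) β * n.factorial / Complex.Gamma (1 + n + β)

lemma Gamma_one_add_natCast_add_ne_zero {β : ℂ} (hβ : 0 < β.re) (n : ℕ) :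
    Complex.Gamma (1 + n + β) ≠ 0 :=
  Complex.Gamma_ne_zero_of_re_pos (by simp; positivity)

lemma Gamma_one_add_natCast_add {β : ℂ} (hβ : 0 < β.re) (n : ℕ) :
    Complex.Gamma (1 + n + β) = (∏ j ∈ range (n + 1), (β + j)) * Complex.Gamma β := by
  induction n with
  | zero =>
    have : β ≠ 0 := by rintro rfl; simp at hβ
    simp [add_comm (1 : ℂ), Complex.Gamma_add_one β this]
  | succ n ih =>
    have h : (1 + n + β : ℂ) ≠ 0 := by
      intro h
      have := congrArg Complex.re h
      simp at this
      have : (0 : ℝ) ≤ n := n.cast_nonneg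
      linarith
    rw [prod_range_succ, mul_right_comm, ← ih]
    push_cast
    rw [show (1 + (n + 1) + β : ℂ) = (1 + n + β) + 1 by ring, Complex.Gamma_add_one _ h]
    ring

lemma tendsto_gammaRatio {β : ℂ} (hβ : 0 < β.re) :
    Tendsto (gammaRatio β) atTop (𝓝 1) := by
  have hΓ : Complex.Gamma β ≠ 0 := Complex.Gamma_ne_zero_of_re_pos hβ
  have h1 := (Complex.GammaSeq_tendsto_Gamma β).div_const (Complex.Gamma β)
  have h2 : Tendsto (fun n : ℕ => cpowR (((n : ℝ) + 1) / n) β) atTop (𝓝 1) := by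
    have h : Tendsto (fun n : ℕ => ((n : ℝ) + 1) / n) atTop (𝓝 1) := by
      have := (tendsto_one_div_atTop_nhds_zero_nat (𝕜 := ℝ)).const_add 1
      rw [add_zero] at this
      refine this.congr' ?_
      filter_upwards [eventually_ne_atTop 0] with n hn
      field_simp
    have := (continuousAt_cpowR one_pos β).tendsto.comp h
    rwa [cpowR_one_left] at this
  have h3 := h1.mul h2
  rw [div_self hΓ, one_mul] at h3
  refine h3.congr' ?_
  filter_upwards [eventually_ne_atTop 0] with n hn
  have hn' : (0 : ℝ) < n := by positivity
  have hc : (n : ℂ) ^ β = cpowR n β := by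
    rw [Complex.cpow_def_of_ne_zero (by exact_mod_cast hn), cpowR, Complex.ofReal_log hn'.le,
      mul_comm, Complex.ofReal_natCast]
  have hne := cpowR_ne_zero n β
  rw [cpowR_div (by positivity) hn', gammaRatio, Gamma_one_add_natCast_add hβ, Complex.GammaSeq, hc]
  field_simp

/-! ### Binomial weights -/

/-- The weight `binom(x + y, x) u ^ x v ^ y` of the pair `(x, y)`. -/
noncomputable def binomWeight (u v : ℝ) (p : ℕ × ℕ) : ℝ :=
  (p.1 + p.2).choose p.1 * (u ^ p.1 * v ^ p.2)

lemma binomWeight_nonneg {u v : ℝ} (hu : 0 ≤ u) (hv : 0 ≤ v) (p : ℕ × ℕ) :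
    0 ≤ binomWeight u v p := by
  unfold binomWeight; positivity

lemma binomWeight_swap (u v : ℝ) (p : ℕ × ℕ) :
    binomWeight u v p.swap = binomWeight v u p := by
  simp only [binomWeight, Prod.fst_swap, Prod.snd_swap, add_comm p.2 p.1]
  rw [Nat.choose_symm_add]
  ring

lemma sum_binomWeight {u v : ℝ} (huv : u + v = 1) (n : ℕ) :
    ∑ p ∈ antidiagonal n, binomWeight u v p = 1 := by
  rw [← one_pow n, ← huv, (Commute.all u v).add_pow']
  refine sum_congr rfl fun p hp => ?_
  rw [binomWeight, mem_antidiagonal.1 hp, nsmul_eq_mul]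

lemma choose_mul_pow_le (x y k : ℕ) :
    (x + y).choose x * (x + y + 1) ^ k ≤
      k.factorial * (x + 1) ^ k * (x + k + y).choose (x + k) := by
  induction k with
  | zero => simp
  | succ k ih =>
    have h := Nat.add_one_mul_choose_eq (x + k + y) (x + k)
    calc (x + y).choose x * (x + y + 1) ^ (k + 1)
        = ((x + y).choose x * (x + y + 1) ^ k) * (x + y + 1) := by ring
      _ ≤ (k.factorial * (x + 1) ^ k * (x + k + y).choose (x + k)) * (x + k + y + 1) := by
          gcongr; omega
      _ = k.factorial * (x + 1) ^ k * ((x + k + y + 1).choose (x + k + 1) * (x + k + 1)) := by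
          rw [← h]; ring
      _ ≤ k.factorial * (x + 1) ^ k *
          ((x + k + y + 1).choose (x + k + 1) * ((k + 1) * (x + 1))) := by
          gcongr; nlinarith
      _ = _ := by
          rw [Nat.factorial_succ, show x + (k + 1) + y = x + k + y + 1 by ring, ← add_assoc]; ring

lemma sum_antidiagonal_shift_le {f : ℕ × ℕ → ℝ} (hf : ∀ p, 0 ≤ f p) (n k : ℕ) :
    ∑ p ∈ antidiagonal n, f (p.1 + k, p.2) ≤ ∑ p ∈ antidiagonal (n + k), f p := by
  induction k generalizing n with
  | zero => simp
  | succ k ih =>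
    calc ∑ p ∈ antidiagonal n, f (p.1 + (k + 1), p.2)
        = ∑ p ∈ antidiagonal n, f (p.1 + 1 + k, p.2) := by simp only [add_assoc, add_comm 1 k]
      _ ≤ ∑ p ∈ antidiagonal (n + 1), f (p.1 + k, p.2) := by
          rw [Nat.sum_antidiagonal_succ]
          linarith [hf (0 + k, n + 1)]
      _ ≤ _ := by
          rw [add_comm k 1, ← add_assoc]; exact ih (n + 1)

/-- Negative moments of the binomial distribution are bounded. -/
lemma sum_binomWeight_mul_pow_le {u v : ℝ} (hu : 0 < u) (hv : 0 ≤ v) (huv : u + v = 1) (n k : ℕ) :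
    ∑ p ∈ antidiagonal n, binomWeight u v p * ((n + 1) / (p.1 + 1)) ^ k ≤
      k.factorial / u ^ k := by
  calc ∑ p ∈ antidiagonal n, binomWeight u v p * ((n + 1 : ℝ) / (p.1 + 1)) ^ k
      ≤ ∑ p ∈ antidiagonal n, k.factorial / u ^ k * binomWeight u v (p.1 + k, p.2) := by
        refine sum_le_sum fun p hp => ?_
        have h : ((p.1 + p.2).choose p.1 * (n + 1) ^ k : ℝ) ≤
            k.factorial * (p.1 + 1) ^ k * (p.1 + k + p.2).choose (p.1 + k) := by
          rw [← mem_antidiagonal.1 hp]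
          exact_mod_cast choose_mul_pow_le p.1 p.2 k
        simp only [binomWeight]
        rw [div_pow, mul_div_assoc', div_le_iff₀ (by positivity)]
        have := mul_le_mul_of_nonneg_right h (by positivity : 0 ≤ u ^ p.1 * v ^ p.2)
        refine (Eq.trans_le ?_ this).trans_eq ?_
        · ring
        · rw [pow_add]; field_simp
    _ ≤ k.factorial / u ^ k * 1 := by
        rw [← mul_sum, ← sum_binomWeight huv (n + k)]
        gcongr
        exact sum_antidiagonal_shift_le (binomWeight_nonneg hu.le hv) n k
    _ = _ := mul_one _

lemma sum_binomWeight_mul_sq {u v : ℝ} (huv : u + v = 1) (n : ℕ) :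
    ∑ p ∈ antidiagonal n, binomWeight u v p * (n * u - p.1) ^ 2 = n * u * v := by
  have h := congrArg (Polynomial.eval u) (bernsteinPolynomial.variance ℝ n)
  obtain rfl : v = 1 - u := by linarith
  rw [Finset.Nat.sum_antidiagonal_eq_sum_range_succ_mk]
  simp only [Polynomial.eval_finsetSum, bernsteinPolynomial, Polynomial.eval_mul,
    Polynomial.eval_pow, Polynomial.eval_sub, Polynomial.eval_natCast, Polynomial.eval_X,
    Polynomial.eval_one, nsmul_eq_mul] at h
  rw [← h]
  refine sum_congr rfl fun x hx => ?_
  have : x + (n - x) = n := by have := mem_range.1 hx; omega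
  simp only [binomWeight, this]
  ring

/-! ### Equidistribution of binomial weights in residue classes -/

lemma IsPrimitiveRoot.sum_pow_mul {ζ : ℂ} {L : ℕ} (hζ : IsPrimitiveRoot ζ L) (x : ℕ) :
    ∑ j ∈ range L, (ζ ^ j) ^ x = if L ∣ x then (L : ℂ) else 0 := by
  simp only [← pow_mul, mul_comm _ x]
  simp only [pow_mul]
  split_ifs with h
  · simp [(hζ.pow_eq_one_iff_dvd x).2 h]
  · have h1 : ζ ^ x ≠ 1 := fun h' => h ((hζ.pow_eq_one_iff_dvd x).1 h')
    rw [geom_sum_eq h1, ← pow_mul, mul_comm, pow_mul, hζ.pow_eq_one, one_pow, sub_self, zero_div]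

lemma sum_binomWeight_mul_pow (u v : ℝ) (z : ℂ) (n k : ℕ) :
    ∑ p ∈ antidiagonal n, (binomWeight u v p : ℂ) * z ^ (p.1 + k) = z ^ k * (u * z + v) ^ n := by
  rw [(Commute.all (u * z) (v : ℂ)).add_pow', mul_sum]
  refine sum_congr rfl fun p hp => ?_
  rw [binomWeight, mem_antidiagonal.1 hp, nsmul_eq_mul]
  push_cast
  ring

lemma tendsto_sum_binomWeight_dvd {u v : ℝ} (hu : 0 < u) (hv : 0 < v) (huv : u + v = 1)
    {L : ℕ} (hL : L ≠ 0) (k : ℕ → ℕ) :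
    Tendsto (fun n => ∑ p ∈ antidiagonal n with L ∣ p.1 + k n, (binomWeight u v p : ℂ)) atTop
      (𝓝 (1 / L)) := by
  have hζ := Complex.isPrimitiveRoot_exp L hL
  set ζ := Complex.exp (2 * Real.pi * Complex.I / L)
  have hL' : (L : ℂ) ≠ 0 := by exact_mod_cast hL
  have hnorm : ∀ j : ℕ, ‖ζ ^ j‖ = 1 := fun j => by
    rw [norm_pow, hζ.norm'_eq_one hL, one_pow]
  have hsum : Tendsto (fun n => ∑ j ∈ range L, (ζ ^ j) ^ k n * (u * ζ ^ j + v) ^ n) atTop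
      (𝓝 (∑ j ∈ range L, if j = 0 then 1 else 0)) := by
    refine tendsto_finsetSum _ fun j hj => ?_
    split_ifs with h0
    · subst h0
      have : (u + v : ℂ) = 1 := by exact_mod_cast huv
      simp [this]
    · have hne : ζ ^ j ≠ 1 := hζ.pow_ne_one_of_pos_of_lt h0 (mem_range.1 hj)
      have hlt : ‖(u * ζ ^ j + v : ℂ)‖ < 1 := by
        have := norm_combo_lt_of_ne (hnorm j).le (norm_one (α := ℂ)).le hne hu hv huv
        simpa using this
      have := tendsto_pow_atTop_nhds_zero_of_lt_one (norm_nonneg _) hlt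
      refine squeeze_zero_norm (fun n => ?_) this
      rw [norm_mul, norm_pow, hnorm, one_pow, one_mul, norm_pow]
  have hone : (∑ j ∈ range L, if j = 0 then (1 : ℂ) else 0) = 1 := by
    rw [sum_ite_eq']
    simp [Nat.pos_of_ne_zero hL]
  rw [hone] at hsum
  refine (hsum.div_const (L : ℂ)).congr fun n => ?_
  simp only [← sum_binomWeight_mul_pow]
  rw [sum_comm, sum_filter, sum_div]
  refine sum_congr rfl fun p _ => ?_
  rw [← mul_sum, hζ.sum_pow_mul]
  split_ifs <;> simp [hL']

lemma exists_dvd_add_iff {rX rY n : ℕ} (hX : rX ≠ 0) (hY : rY ≠ 0) (hn : Nat.gcd rX rY ∣ n) :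
    ∃ k, ∀ p ∈ antidiagonal n, (rX ∣ p.1 ∧ rY ∣ p.2) ↔ Nat.lcm rX rY ∣ p.1 + k := by
  have h0 : 0 ≡ n [MOD Nat.gcd rX rY] := (Nat.modEq_zero_iff_dvd.2 hn).symm
  obtain ⟨c, hcX, hcY⟩ := Nat.chineseRemainder' h0
  have hL : 1 ≤ Nat.lcm rX rY := Nat.pos_of_ne_zero (Nat.lcm_ne_zero hX hY)
  refine ⟨c * (Nat.lcm rX rY - 1), fun p hp => ?_⟩
  rw [Nat.lcm_dvd_iff]
  refine and_congr ?_ ?_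
  · exact (Nat.dvd_add_left ((Nat.modEq_zero_iff_dvd.1 hcX).mul_right _)).symm
  · have h1 : (rY : ℤ) ∣ n - c := Nat.modEq_iff_dvd.1 hcY
    have h2 : (rY : ℤ) ∣ c * Nat.lcm rX rY :=
      (Int.natCast_dvd_natCast.2 (Nat.dvd_lcm_right rX rY)).mul_left _
    have hpn : (p.1 + p.2 : ℤ) = n := by exact_mod_cast mem_antidiagonal.1 hp
    rw [← Int.natCast_dvd_natCast, ← Int.natCast_dvd_natCast]
    push_cast [Nat.cast_sub hL]
    rw [show (p.1 + c * (Nat.lcm rX rY - 1) : ℤ) = (n - c + c * Nat.lcm rX rY) - p.2 by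
      rw [← hpn]; ring]
    exact (dvd_sub_right (dvd_add h1 h2)).symm

/-! ### Concentration of binomial weights -/

/-- The filter on pairs `(x, y)` for which `x + y → ∞` and `x / (x + y) → u`. -/
noncomputable def bulkFilter (u : ℝ) : Filter (ℕ × ℕ) :=
  comap (fun p : ℕ × ℕ => p.1 + p.2) atTop ⊓
    comap (fun p : ℕ × ℕ => (p.1 : ℝ) / (p.1 + p.2)) (𝓝 u)

/-- Sums of a quantity with bounded second moment that is small near the mean tend to zero. -/
lemma tendsto_sum_binomWeight_mul_zero {u v : ℝ} (hu : 0 < u) (hv : 0 < v) (huv : u + v = 1)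
    {D : ℕ × ℕ → ℝ} {M : ℝ}
    (hM : ∀ n, ∑ p ∈ antidiagonal n, binomWeight u v p * D p ^ 2 ≤ M)
    (hD0 : ∀ p, 0 ≤ D p)
    (hD : Tendsto D (bulkFilter u) (𝓝 0)) :
    Tendsto (fun n => ∑ p ∈ antidiagonal n, binomWeight u v p * D p) atTop (𝓝 0) := by
  have hw := binomWeight_nonneg hu.le hv.le
  have hM0 : 0 ≤ M := (sum_nonneg fun p _ => mul_nonneg (hw p) (sq_nonneg _)).trans (hM 0)
  rw [Metric.tendsto_atTop]
  intro ε hε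
  obtain ⟨⟨N, δ⟩, ⟨-, hδ⟩, hN⟩ := (((atTop_basis.comap _).inf
    (Metric.nhds_basis_ball.comap _)).tendsto_iff Metric.nhds_basis_ball).1 hD (ε / 4)
    (by positivity)
  obtain ⟨η, hη, hηM⟩ : ∃ η > 0, η * M ≤ ε / 4 :=
    ⟨ε / 4 / (M + 1), by positivity, by
      rw [div_mul_eq_mul_div, div_le_iff₀ (by positivity)]; nlinarith⟩
  obtain ⟨N', hN'⟩ := exists_nat_gt (1 / (4 * η * δ ^ 2) / (ε / 4))
  refine ⟨max N (N' + 1), fun n hn => ?_⟩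
  have hnN : N ≤ n := le_of_max_le_left hn
  have hnN' : N' + 1 ≤ n := le_of_max_le_right hn
  have hn0 : (0 : ℝ) < n := by exact_mod_cast (by omega : 0 < n)
  rw [Real.dist_0_eq_abs, abs_of_nonneg (sum_nonneg fun p _ => mul_nonneg (hw p) (hD0 p))]
  have hpt : ∀ p ∈ antidiagonal n, binomWeight u v p * D p ≤
      binomWeight u v p * (ε / 4) + η * (binomWeight u v p * D p ^ 2) +
        1 / (4 * η * δ ^ 2 * n ^ 2) * (binomWeight u v p * (n * u - p.1) ^ 2) := by
    intro p hp
    have hpn : (p.1 + p.2 : ℝ) = n := by exact_mod_cast mem_antidiagonal.1 hp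
    suffices h : D p ≤ ε / 4 + η * D p ^ 2 + 1 / (4 * η * δ ^ 2 * n ^ 2) * (n * u - p.1) ^ 2 by
      have := mul_le_mul_of_nonneg_left h (hw p)
      linarith
    by_cases hpδ : |(p.1 : ℝ) / n - u| < δ
    · have := hN p ⟨by simpa [mem_antidiagonal.1 hp] using hnN, by
        simpa [Real.dist_eq, hpn] using hpδ⟩
      rw [Metric.mem_ball, Real.dist_0_eq_abs, abs_of_nonneg (hD0 p)] at this
      have : 0 ≤ η * D p ^ 2 := by positivity
      have : 0 ≤ 1 / (4 * η * δ ^ 2 * n ^ 2) * (n * u - p.1) ^ 2 := by positivity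
      linarith
    · have h1 : δ ^ 2 * n ^ 2 ≤ (n * u - p.1) ^ 2 := by
        rw [← mul_pow, ← sq_abs (n * u - p.1 : ℝ)]
        gcongr
        rw [not_lt] at hpδ
        calc δ * n ≤ |(p.1 : ℝ) / n - u| * |(n : ℝ)| := by
              rw [abs_of_pos hn0]; gcongr
          _ = |n * u - p.1| := by
              rw [← abs_mul, abs_sub_comm]; congr 1; field_simp
      have h2 : 1 / (4 * η) ≤ 1 / (4 * η * δ ^ 2 * n ^ 2) * (n * u - p.1) ^ 2 := by
        rw [div_mul_eq_mul_div, div_le_div_iff₀ (by positivity) (by positivity)]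
        nlinarith
      have h3 : D p ≤ η * D p ^ 2 + 1 / (4 * η) := by
        have : η * D p ^ 2 + 1 / (4 * η) - D p = η * (D p - 1 / (2 * η)) ^ 2 := by
          field_simp; ring
        have : 0 ≤ η * (D p - 1 / (2 * η)) ^ 2 := by positivity
        linarith
      linarith
  have hvar : 1 / (4 * η * δ ^ 2 * n ^ 2) * (n * u * v) < ε / 4 := by
    have h1 : u * v ≤ 1 := by nlinarith
    have h2 : 1 / (4 * η * δ ^ 2) / (ε / 4) < n := hN'.trans (by exact_mod_cast hnN')
    rw [div_lt_iff₀ (by positivity)] at h2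
    calc 1 / (4 * η * δ ^ 2 * n ^ 2) * (n * u * v) = 1 / (4 * η * δ ^ 2) * (u * v) / n := by
          field_simp
      _ ≤ 1 / (4 * η * δ ^ 2) * 1 / n := by gcongr
      _ < ε / 4 := by rw [mul_one, div_lt_iff₀ hn0]; linarith
  have hs := sum_le_sum hpt
  rw [sum_add_distrib, sum_add_distrib, ← sum_mul, ← mul_sum, ← mul_sum, sum_binomWeight huv,
    sum_binomWeight_mul_sq huv] at hs
  have := mul_le_mul_of_nonneg_left (hM n) hη.le
  linarith

lemma tendsto_add_bulkFilter (u : ℝ) :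
    Tendsto (fun p : ℕ × ℕ => p.1 + p.2) (bulkFilter u) atTop :=
  tendsto_comap.mono_left inf_le_left

lemma tendsto_div_bulkFilter (u : ℝ) :
    Tendsto (fun p : ℕ × ℕ => (p.1 : ℝ) / (p.1 + p.2)) (bulkFilter u) (𝓝 u) :=
  tendsto_comap.mono_left inf_le_right

lemma tendsto_swap_bulkFilter {u v : ℝ} (huv : u + v = 1) :
    Tendsto Prod.swap (bulkFilter u) (bulkFilter v) := by
  refine tendsto_inf.2 ⟨tendsto_comap_iff.2 ?_, tendsto_comap_iff.2 ?_⟩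
  · simpa [Function.comp_def, add_comm] using tendsto_add_bulkFilter u
  · have h := (tendsto_div_bulkFilter u).const_sub 1
    rw [show 1 - u = v by linarith] at h
    refine h.congr' ?_
    filter_upwards [(tendsto_add_bulkFilter u).eventually_ne_atTop 0] with p hp
    have hp' : (p.1 + p.2 : ℝ) ≠ 0 := by exact_mod_cast hp
    simp only [Function.comp_apply, Prod.fst_swap, Prod.snd_swap, add_comm (p.2 : ℝ)]
    field_simp
    ring

lemma tendsto_fst_bulkFilter {u : ℝ} (hu : 0 < u) :
    Tendsto (Prod.fst : ℕ × ℕ → ℕ) (bulkFilter u) atTop := by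
  rw [← tendsto_natCast_atTop_iff (R := ℝ)]
  have h := (tendsto_div_bulkFilter u).pos_mul_atTop hu
    (tendsto_natCast_atTop_atTop.comp (tendsto_add_bulkFilter u))
  refine h.congr' ?_
  filter_upwards [(tendsto_add_bulkFilter u).eventually_ne_atTop 0] with p hp
  have hp' : (p.1 + p.2 : ℝ) ≠ 0 := by exact_mod_cast hp
  simp [hp']

lemma tendsto_ratio_bulkFilter {u : ℝ} (hu : 0 < u) :
    Tendsto (fun p : ℕ × ℕ => ((p.1 + p.2 : ℕ) + 1 : ℝ) / (p.1 + 1) * u) (bulkFilter u) (𝓝 1) := by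
  have h0 := (tendsto_one_div_atTop_nhds_zero_nat (𝕜 := ℝ)).comp (tendsto_add_bulkFilter u)
  have h := ((h0.const_add 1).div ((tendsto_div_bulkFilter u).add h0)
    (by simpa using hu.ne')).mul_const u
  rw [add_zero, add_zero, one_div_mul_cancel hu.ne'] at h
  refine h.congr' ?_
  filter_upwards [(tendsto_add_bulkFilter u).eventually_ne_atTop 0] with p hp
  have hp' : (p.1 + p.2 : ℝ) ≠ 0 := by exact_mod_cast hp
  simp only [Pi.div_apply, Function.comp_apply, Nat.cast_add]
  field_simp

lemma tendsto_cpowR_ratio_bulkFilter {u : ℝ} (hu : 0 < u) (β : ℂ) :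
    Tendsto (fun p : ℕ × ℕ => cpowR (((p.1 + p.2 : ℕ) + 1 : ℝ) / (p.1 + 1) * u) β)
      (bulkFilter u) (𝓝 1) := by
  have := (continuousAt_cpowR one_pos β).tendsto.comp (tendsto_ratio_bulkFilter hu)
  rwa [cpowR_one_left] at this

lemma norm_cpowR_mul_le {s u : ℝ} (hs : 1 ≤ s) (hu : 0 < u) (hu1 : u ≤ 1) {β : ℂ} {k : ℕ}
    (hβ : 0 ≤ β.re) (hk : β.re ≤ k) : ‖cpowR (s * u) β‖ ≤ s ^ k := by
  have hs0 : 0 < s := by linarith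
  rw [norm_cpowR (by positivity)]
  calc (s * u) ^ β.re ≤ s ^ β.re := by
        gcongr
        nlinarith
    _ ≤ s ^ (k : ℝ) := Real.rpow_le_rpow_of_exponent_le hs hk
    _ = s ^ k := Real.rpow_natCast s k

lemma exists_norm_le_of_tendsto {φ : ℕ → ℂ} {A : ℂ} (h : Tendsto φ atTop (𝓝 A)) :
    ∃ C, ∀ n, ‖φ n‖ ≤ C := by
  obtain ⟨C, hC⟩ := (Metric.isBounded_range_of_tendsto φ h).exists_norm_le
  exact ⟨C, fun n => hC _ ⟨n, rfl⟩⟩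

/-- The factor by which the binomial weights are perturbed. -/
noncomputable def binomFactor (u v : ℝ) (βX βY : ℂ) (φ ψ χ : ℕ → ℂ) (p : ℕ × ℕ) : ℂ :=
  φ p.1 * ψ p.2 * χ (p.1 + p.2) *
    (cpowR (((p.1 + p.2 : ℕ) + 1 : ℝ) / (p.1 + 1) * u) βX *
      cpowR (((p.1 + p.2 : ℕ) + 1 : ℝ) / (p.2 + 1) * v) βY)

lemma tendsto_binomFactor {u v : ℝ} (hu : 0 < u) (hv : 0 < v) (huv : u + v = 1) (βX βY : ℂ)
    {φ ψ χ : ℕ → ℂ} {A B : ℂ} (hφ : Tendsto φ atTop (𝓝 A)) (hψ : Tendsto ψ atTop (𝓝 B))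
    (hχ : Tendsto χ atTop (𝓝 1)) :
    Tendsto (binomFactor u v βX βY φ ψ χ) (bulkFilter u) (𝓝 (A * B)) := by
  have hswap := tendsto_swap_bulkFilter huv
  have h1 := hφ.comp (tendsto_fst_bulkFilter hu)
  have h2 := hψ.comp ((tendsto_fst_bulkFilter hv).comp hswap)
  have h3 := hχ.comp (tendsto_add_bulkFilter u)
  have h4 := tendsto_cpowR_ratio_bulkFilter hu βX
  have h5 := (tendsto_cpowR_ratio_bulkFilter hv βY).comp hswap
  have h := ((h1.mul h2).mul h3).mul (h4.mul h5)
  simp only [mul_one] at h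
  refine h.congr fun p => ?_
  simp only [binomFactor, Function.comp_apply, Prod.fst_swap, Prod.snd_swap, add_comm p.2]

lemma exists_norm_binomFactor_le {u v : ℝ} (hu : 0 < u) (hv : 0 < v) (huv : u + v = 1)
    {βX βY : ℂ} (hβX : 0 < βX.re) (hβY : 0 < βY.re)
    {φ ψ χ : ℕ → ℂ} {A B E : ℂ} (hφ : Tendsto φ atTop (𝓝 A)) (hψ : Tendsto ψ atTop (𝓝 B))
    (hχ : Tendsto χ atTop (𝓝 E)) :
    ∃ (C : ℝ) (k : ℕ), 0 ≤ C ∧ ∀ p, ‖binomFactor u v βX βY φ ψ χ p‖ ≤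
      C * (((p.1 + p.2 : ℕ) + 1 : ℝ) / (p.1 + 1) + ((p.1 + p.2 : ℕ) + 1 : ℝ) / (p.2 + 1)) ^ k := by
  obtain ⟨Cφ, hCφ⟩ := exists_norm_le_of_tendsto hφ
  obtain ⟨Cψ, hCψ⟩ := exists_norm_le_of_tendsto hψ
  obtain ⟨Cχ, hCχ⟩ := exists_norm_le_of_tendsto hχ
  have h1 : 0 ≤ Cφ := (norm_nonneg _).trans (hCφ 0)
  have h2 : 0 ≤ Cψ := (norm_nonneg _).trans (hCψ 0)
  have h3 : 0 ≤ Cχ := (norm_nonneg _).trans (hCχ 0)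
  obtain ⟨k, hk⟩ := exists_nat_ge (max βX.re βY.re)
  refine ⟨Cφ * Cψ * Cχ, k, by positivity, fun p => ?_⟩
  set s : ℝ := ((p.1 + p.2 : ℕ) + 1 : ℝ) / (p.1 + 1) with hs
  set t : ℝ := ((p.1 + p.2 : ℕ) + 1 : ℝ) / (p.2 + 1) with ht
  have hs1 : 1 ≤ s := by
    rw [hs, le_div_iff₀ (by positivity)]; push_cast; linarith [p.2.cast_nonneg (α := ℝ)]
  have ht1 : 1 ≤ t := by
    rw [ht, le_div_iff₀ (by positivity)]; push_cast; linarith [p.1.cast_nonneg (α := ℝ)]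
  have hst : s * t ≤ s + t := by
    rw [hs, ht, div_mul_div_comm, div_add_div _ _ (by positivity) (by positivity)]
    gcongr
    push_cast
    nlinarith [p.1.cast_nonneg (α := ℝ), p.2.cast_nonneg (α := ℝ)]
  calc ‖binomFactor u v βX βY φ ψ χ p‖
      = ‖φ p.1‖ * ‖ψ p.2‖ * ‖χ (p.1 + p.2)‖ * (‖cpowR (s * u) βX‖ * ‖cpowR (t * v) βY‖) := by
        simp only [binomFactor, norm_mul, hs, ht]
    _ ≤ Cφ * Cψ * Cχ * (s ^ k * t ^ k) := by
        gcongr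
        · exact hCφ _
        · exact hCψ _
        · exact hCχ _
        · exact norm_cpowR_mul_le hs1 hu (by linarith) hβX.le ((le_max_left _ _).trans hk)
        · exact norm_cpowR_mul_le ht1 hv (by linarith) hβY.le ((le_max_right _ _).trans hk)
    _ ≤ Cφ * Cψ * Cχ * (s + t) ^ k := by
        rw [← mul_pow]
        gcongr

lemma tendsto_sum_binomWeight_mul_norm_sub {u v : ℝ} (hu : 0 < u) (hv : 0 < v) (huv : u + v = 1)
    {βX βY : ℂ} (hβX : 0 < βX.re) (hβY : 0 < βY.re)
    {φ ψ χ : ℕ → ℂ} {A B : ℂ} (hφ : Tendsto φ atTop (𝓝 A)) (hψ : Tendsto ψ atTop (𝓝 B))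
    (hχ : Tendsto χ atTop (𝓝 1)) :
    Tendsto (fun n => ∑ p ∈ antidiagonal n,
      binomWeight u v p * ‖binomFactor u v βX βY φ ψ χ p - A * B‖) atTop (𝓝 0) := by
  obtain ⟨C, k, hC, hCk⟩ := exists_norm_binomFactor_le hu hv huv hβX hβY hφ hψ hχ
  have hlim := ((tendsto_binomFactor hu hv huv βX βY hφ hψ hχ).sub_const (A * B)).norm
  rw [sub_self, norm_zero] at hlim
  set K : ℝ := (C + ‖A * B‖) ^ 2 * 2 ^ (2 * k - 1)
  refine tendsto_sum_binomWeight_mul_zero hu hv huv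
    (M := K * ((2 * k).factorial / u ^ (2 * k) + (2 * k).factorial / v ^ (2 * k)))
    (fun n => ?_) (fun _ => norm_nonneg _) hlim
  have hw := binomWeight_nonneg hu.le hv.le
  calc ∑ p ∈ antidiagonal n, binomWeight u v p * ‖binomFactor u v βX βY φ ψ χ p - A * B‖ ^ 2
      ≤ ∑ p ∈ antidiagonal n, K * (binomWeight u v p * ((n + 1) / (p.1 + 1)) ^ (2 * k) +
          binomWeight u v p * ((n + 1) / (p.2 + 1)) ^ (2 * k)) := by
        refine sum_le_sum fun p hp => ?_
        have hb := hCk p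
        have hp' := mem_antidiagonal.1 hp
        rw [hp'] at hb
        set s : ℝ := ((n : ℝ) + 1) / (p.1 + 1) with hs
        set t : ℝ := ((n : ℝ) + 1) / (p.2 + 1) with ht
        have hs1 : 1 ≤ s := by
          rw [hs, le_div_iff₀ (by positivity), ← hp']
          push_cast; linarith [p.2.cast_nonneg (α := ℝ)]
        have ht0 : 0 ≤ t := by positivity
        have h1 : ‖binomFactor u v βX βY φ ψ χ p - A * B‖ ≤ (C + ‖A * B‖) * (s + t) ^ k := by
          have : 1 ≤ (s + t) ^ k := one_le_pow₀ (by linarith)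
          have := le_mul_of_one_le_right (norm_nonneg (A * B)) this
          linarith [norm_sub_le (binomFactor u v βX βY φ ψ χ p) (A * B)]
        have h2 := add_pow_le (by linarith : 0 ≤ s) ht0 (2 * k)
        calc _ ≤ binomWeight u v p * ((C + ‖A * B‖) * (s + t) ^ k) ^ 2 := by
              gcongr
              exact hw p
          _ = binomWeight u v p * ((C + ‖A * B‖) ^ 2 * (s + t) ^ (2 * k)) := by
              rw [mul_pow, ← pow_mul, mul_comm k]
          _ ≤ binomWeight u v p * ((C + ‖A * B‖) ^ 2 *
              (2 ^ (2 * k - 1) * (s ^ (2 * k) + t ^ (2 * k)))) := by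
              gcongr
              exact hw p
          _ = _ := by ring
    _ ≤ _ := by
        rw [← mul_sum, sum_add_distrib]
        gcongr
        · exact sum_binomWeight_mul_pow_le hu hv.le huv n (2 * k)
        · rw [← Nat.sum_antidiagonal_swap]
          simp only [binomWeight_swap, Prod.snd_swap]
          exact sum_binomWeight_mul_pow_le hv hu.le (by linarith) n (2 * k)

/-! ### Products of asymptotically Mittag-Leffler sequences -/

/-- Perturbed binomial weights equidistribute over the pairs `(x, y)` with `rX ∣ x`, `rY ∣ y`. -/
lemma tendsto_sum_binomWeight_mul_binomFactor {rX rY : ℕ} (hX : rX ≠ 0) (hY : rY ≠ 0)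
    {u v : ℝ} (hu : 0 < u) (hv : 0 < v) (huv : u + v = 1)
    {βX βY : ℂ} (hβX : 0 < βX.re) (hβY : 0 < βY.re)
    {φ ψ χ : ℕ → ℂ} {A B : ℂ} (hφ : Tendsto φ atTop (𝓝 A)) (hψ : Tendsto ψ atTop (𝓝 B))
    (hχ : Tendsto χ atTop (𝓝 1)) :
    Tendsto (fun m => ∑ p ∈ antidiagonal (Nat.gcd rX rY * m) with rX ∣ p.1 ∧ rY ∣ p.2,
      (binomWeight u v p : ℂ) * binomFactor u v βX βY φ ψ χ p) atTop
      (𝓝 (1 / (Nat.lcm rX rY : ℕ) * (A * B))) := by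
  have hr : Tendsto (fun m => Nat.gcd rX rY * m) atTop atTop :=
    tendsto_id.const_mul_atTop' (Nat.gcd_pos_of_pos_left _ (Nat.pos_of_ne_zero hX))
  have hk : ∀ n, ∃ k, Nat.gcd rX rY ∣ n →
      ∀ p ∈ antidiagonal n, (rX ∣ p.1 ∧ rY ∣ p.2) ↔ Nat.lcm rX rY ∣ p.1 + k := fun n => by
    by_cases hn : Nat.gcd rX rY ∣ n
    · obtain ⟨k, hk⟩ := exists_dvd_add_iff hX hY hn
      exact ⟨k, fun _ => hk⟩
    · exact ⟨0, fun h => absurd h hn⟩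
  choose k hk using hk
  have hmain := ((tendsto_sum_binomWeight_dvd hu hv huv (Nat.lcm_ne_zero hX hY) k).mul_const
    (A * B)).comp hr
  have herr : Tendsto (fun m => ∑ p ∈ antidiagonal (Nat.gcd rX rY * m) with rX ∣ p.1 ∧ rY ∣ p.2,
      (binomWeight u v p : ℂ) * (binomFactor u v βX βY φ ψ χ p - A * B)) atTop (𝓝 0) := by
    refine squeeze_zero_norm (fun m => ?_)
      ((tendsto_sum_binomWeight_mul_norm_sub hu hv huv hβX hβY hφ hψ hχ).comp hr)
    have hw := binomWeight_nonneg hu.le hv.le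
    refine (norm_sum_le _ _).trans ?_
    simp only [norm_mul, Complex.norm_real, Real.norm_of_nonneg (hw _)]
    exact sum_le_sum_of_subset_of_nonneg (filter_subset _ _)
      fun p _ _ => mul_nonneg (hw p) (norm_nonneg _)
  have h := hmain.add herr
  rw [add_zero] at h
  refine h.congr fun m => ?_
  simp only [Function.comp_apply]
  rw [filter_congr fun p hp => (hk _ (dvd_mul_right _ m) p hp).symm, sum_mul, ← sum_add_distrib]
  exact sum_congr rfl fun p _ => by ring

/-- The scaled product of two terms as a perturbed binomial weight. -/
lemma mul_Gamma_div_cpowR_eq {βX βY : ℂ} (hβX : 0 < βX.re) (hβY : 0 < βY.re) {TX TY : ℝ}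
    (hTX : 0 < TX) (hTY : 0 < TY) (a b : ℕ → ℂ) (p : ℕ × ℕ) :
    a p.1 * b p.2 * Complex.Gamma (1 + (p.1 + p.2 : ℕ) + (βX + βY)) /
        cpowR (TX + TY) ((p.1 + p.2 : ℕ) + (βX + βY)) =
      binomWeight (TX / (TX + TY)) (TY / (TX + TY)) p *
        binomFactor (TX / (TX + TY)) (TY / (TX + TY)) βX βY
          (fun x => a x * Complex.Gamma (1 + x + βX) / cpowR TX (x + βX) * gammaRatio βX x)
          (fun y => b y * Complex.Gamma (1 + y + βY) / cpowR TY (y + βY) * gammaRatio βY y)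
          (fun n => (gammaRatio (βX + βY) n)⁻¹) p := by
  obtain ⟨x, y⟩ := p
  have hT : 0 < TX + TY := by positivity
  have hTc : (TX + TY : ℂ) ≠ 0 := by exact_mod_cast hT.ne'
  have hΓX := Gamma_one_add_natCast_add_ne_zero hβX x
  have hΓY := Gamma_one_add_natCast_add_ne_zero hβY y
  have hΓ := Gamma_one_add_natCast_add_ne_zero
    (show 0 < (βX + βY).re by rw [Complex.add_re]; positivity) (x + y)
  have hfac : ((x + y).choose x * x.factorial * y.factorial : ℂ) = (x + y).factorial := by
    rw [Nat.choose_symm_add]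
    exact_mod_cast Nat.add_choose_mul_factorial_mul_factorial x y
  have hTXc : (TX : ℂ) ≠ 0 := by exact_mod_cast hTX.ne'
  have hTYc : (TY : ℂ) ≠ 0 := by exact_mod_cast hTY.ne'
  have hxf : (x.factorial : ℂ) ≠ 0 := by exact_mod_cast x.factorial_ne_zero
  have hyf : (y.factorial : ℂ) ≠ 0 := by exact_mod_cast y.factorial_ne_zero
  have hcf : ((x + y).choose x : ℂ) ≠ 0 := by
    exact_mod_cast (Nat.choose_pos (Nat.le_add_right x y)).ne'
  have hx0 : (0 : ℝ) < x + 1 := by positivity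
  have hy0 : (0 : ℝ) < y + 1 := by positivity
  have hn0 : (0 : ℝ) < (x + y : ℕ) + 1 := by positivity
  simp only [binomWeight, binomFactor, gammaRatio, ← hfac]
  rw [cpowR_mul (div_pos hn0 hx0) (div_pos hTX hT), cpowR_mul (div_pos hn0 hy0) (div_pos hTY hT),
    cpowR_div hn0 hx0, cpowR_div hn0 hy0, cpowR_div hTX hT, cpowR_div hTY hT,
    cpowR_add _ (x : ℂ), cpowR_add _ (y : ℂ), cpowR_add _ ((x + y : ℕ) : ℂ),
    cpowR_add _ βX, cpowR_add _ βX, cpowR_natCast hTX, cpowR_natCast hTY, cpowR_natCast hT]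
  have h1 := cpowR_ne_zero TX βX
  have h2 := cpowR_ne_zero TY βY
  have h3 := cpowR_ne_zero (TX + TY) βX
  have h4 := cpowR_ne_zero (TX + TY) βY
  have h5 := cpowR_ne_zero (x + 1) βX
  have h6 := cpowR_ne_zero (y + 1) βY
  have h7 := cpowR_ne_zero ((x + y : ℕ) + 1) βX
  have h8 := cpowR_ne_zero ((x + y : ℕ) + 1) βY
  generalize cpowR ((x + y : ℕ) + 1) βX = c7 at *
  generalize cpowR ((x + y : ℕ) + 1) βY = c8 at *
  generalize Complex.Gamma (1 + (x + y : ℕ) + (βX + βY)) = G at *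
  generalize Complex.Gamma (1 + x + βX) = GX at *
  generalize Complex.Gamma (1 + y + βY) = GY at *
  push_cast
  rw [div_pow, div_pow, pow_add]
  field_simp

lemma sum_filter_mul_add_mul_eq {rX rY : ℕ} (hX : 1 ≤ rX) (hY : 1 ≤ rY) (n : ℕ)
    (F : ℕ × ℕ → ℂ) :
    ∑ p ∈ (range (n + 1) ×ˢ range (n + 1)).filter (fun p : ℕ × ℕ => rX * p.1 + rY * p.2 = n), F p =
      ∑ q ∈ antidiagonal n with rX ∣ q.1 ∧ rY ∣ q.2, F (q.1 / rX, q.2 / rY) := by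
  refine sum_nbij' (fun p => (rX * p.1, rY * p.2)) (fun q => (q.1 / rX, q.2 / rY)) ?_ ?_ ?_ ?_ ?_
  · intro p hp
    simpa using (mem_filter.1 hp).2
  · rintro ⟨q1, q2⟩ hq
    obtain ⟨hq, ⟨x, rfl⟩, ⟨y, rfl⟩⟩ := mem_filter.1 hq
    rw [HasAntidiagonal.mem_antidiagonal] at hq
    dsimp only at hq ⊢
    rw [Nat.mul_div_cancel_left _ hX, Nat.mul_div_cancel_left _ hY]
    simp only [mem_filter, mem_product, mem_range]
    exact ⟨⟨by nlinarith, by nlinarith⟩, hq⟩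
  · intro p _
    simp [Nat.mul_div_cancel_left _ hX, Nat.mul_div_cancel_left _ hY]
  · intro q hq
    obtain ⟨-, h1, h2⟩ := mem_filter.1 hq
    simp [Nat.mul_div_cancel' h1, Nat.mul_div_cancel' h2]
  · intro p _
    simp [Nat.mul_div_cancel_left _ hX, Nat.mul_div_cancel_left _ hY]

lemma isAML_zero_iff {r : ℕ} {β : ℂ} {a : ℕ → ℂ} {T : ℝ} {A : ℂ} :
    IsAML r β a T 0 A ↔ Tendsto (fun m : ℕ => a m * Complex.Gamma (1 + (r * m : ℕ) + β) /
      cpowR T ((r * m : ℕ) + β)) atTop (𝓝 A) := by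
  simp [IsAML]

/-- Extending the terms of an asymptotically Mittag-Leffler sequence to exponents that are not
multiples of `r`. -/
noncomputable def extendedTerm (r : ℕ) (β : ℂ) (a : ℕ → ℂ) (T : ℝ) (x : ℕ) : ℂ :=
  a (x / r) * Complex.Gamma (1 + (r * (x / r) : ℕ) + β) / cpowR T ((r * (x / r) : ℕ) + β) *
    gammaRatio β x

lemma IsAML.tendsto_extendedTerm {r : ℕ} (hr : 1 ≤ r) {β : ℂ} (hβ : 0 < β.re) {a : ℕ → ℂ} {T : ℝ}
    {A : ℂ} (h : IsAML r β a T 0 A) : Tendsto (extendedTerm r β a T) atTop (𝓝 A) := by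
  have := ((isAML_zero_iff.1 h).comp (Nat.tendsto_div_const_atTop (by omega : r ≠ 0))).mul
    (tendsto_gammaRatio hβ)
  rwa [mul_one] at this

theorem stmt15 (rX rY : ℕ) (hrX : 1 ≤ rX) (hrY : 1 ≤ rY)
    (βX βY : ℂ) (hβX : 0 < βX.re) (hβY : 0 < βY.re)
    (TX TY : ℝ) (hTX : 0 < TX) (hTY : 0 < TY) (AX AY : ℂ) (a b : ℕ → ℂ)
    (haML : IsAML rX βX a TX 0 AX) (hbML : IsAML rY βY b TY 0 AY) :
    IsAML (Nat.gcd rX rY) (βX + βY)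
      (fun m : ℕ =>
        ∑ p ∈ (Finset.range (Nat.gcd rX rY * m + 1) ×ˢ
            Finset.range (Nat.gcd rX rY * m + 1)).filter
            (fun p : ℕ × ℕ => rX * p.1 + rY * p.2 = Nat.gcd rX rY * m),
          a p.1 * b p.2)
      (TX + TY) 0 (((Nat.gcd rX rY : ℂ) / ((rX : ℂ) * (rY : ℂ))) * AX * AY) := by
  have hT : 0 < TX + TY := by positivity
  have hu : 0 < TX / (TX + TY) := by positivity
  have hv : 0 < TY / (TX + TY) := by positivity
  have huv : TX / (TX + TY) + TY / (TX + TY) = 1 := by field_simp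
  have hβ : 0 < (βX + βY).re := by rw [Complex.add_re]; positivity
  have hχ : Tendsto (fun n => (gammaRatio (βX + βY) n)⁻¹) atTop (𝓝 1) := by
    simpa using (tendsto_gammaRatio hβ).inv₀ one_ne_zero
  have h := tendsto_sum_binomWeight_mul_binomFactor (by omega : rX ≠ 0)
    (by omega : rY ≠ 0) hu hv huv hβX hβY (haML.tendsto_extendedTerm hrX hβX)
    (hbML.tendsto_extendedTerm hrY hβY) hχ
  have hlim : (1 / (Nat.lcm rX rY : ℕ) * (AX * AY) : ℂ) =
      (Nat.gcd rX rY : ℂ) / ((rX : ℂ) * (rY : ℂ)) * AX * AY := by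
    have hgl : (Nat.gcd rX rY * Nat.lcm rX rY : ℂ) = rX * rY := by
      exact_mod_cast Nat.gcd_mul_lcm rX rY
    have hg : (Nat.gcd rX rY : ℂ) ≠ 0 := by
      exact_mod_cast (Nat.gcd_pos_of_pos_left _ hrX).ne'
    have hl : (Nat.lcm rX rY : ℂ) ≠ 0 := by
      exact_mod_cast Nat.lcm_ne_zero (by omega) (by omega)
    rw [← hgl]
    field_simp
  rw [isAML_zero_iff, ← hlim]
  refine h.congr fun m => ?_
  rw [sum_filter_mul_add_mul_eq hrX hrY _ fun p => a p.1 * b p.2, sum_mul, sum_div]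
  refine sum_congr rfl fun q hq => ?_
  obtain ⟨hq, h1, h2⟩ := mem_filter.1 hq
  have key := mul_Gamma_div_cpowR_eq hβX hβY hTX hTY (fun x => a (x / rX)) (fun y => b (y / rY)) q
  rw [← mem_antidiagonal.1 hq, key]
  simp only [binomFactor, extendedTerm, Nat.mul_div_cancel' h1, Nat.mul_div_cancel' h2]
end

section
/- Let N ≥ 1 be an integer and let δ ∈ ℂ with Re δ > −1. Then lim_{m→∞} Γ(1 + (N+1)·m + N/2 + (N+1)·δ) / ( Γ(1 + m + δ)^{N+1} · (N+1)^{(N+1)·m + N/2 + (N+1)·δ} ) = (2π)^{−N/2}·(N+1)^{1/2}, where (N+1)^z := exp(z·log(N+1)) with the real logarithm. (Equivalently: the coefficients J_m = Γ(1+δ)^{N+1}/Γ(1+m+δ)^{N+1} of the J-function of ℙ^N satisfy J_m ~ (N+1)^{(N+1)m+N/2+(N+1)δ}/Γ(1+(N+1)m+N/2+(N+1)δ) · (N+1)^{1/2}(2π)^{−N/2}Γ(1+δ)^{N+1}, i.e. t^{N/2}J(t) is (N+1, A)-scaled asymptotically Mittag-Leffler with A = (N+1)^{1/2}(2π)^{−N/2}Γ(1+δ)^{N+1}.)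 -/
theorem ascPochhammer_eval_eq_prod_range {R : Type*} [CommRing R] (n : ℕ) (r : R) :
    (ascPochhammer R n).eval r = ∏ j ∈ Finset.range n, (r + j) := by
  induction n with
  | zero => simp
  | succ n ih => simp [ascPochhammer_succ_right, ih, ← Finset.prod_range_succ]

open Filter Topology in
/-- `Γ(z + n + 1) ~ n ^ z * n!` as `n → ∞`, for every complex `z`. -/
theorem tendsto_Gamma_add_nat_div (z : ℂ) :
    Tendsto (fun n : ℕ => Complex.Gamma (z + n + 1) / ((n : ℂ) ^ z * (n.factorial : ℂ)))
      atTop (𝓝 1) := by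
  obtain ⟨k, hk⟩ := exists_nat_gt (-z.re)
  induction k generalizing z with
  | zero =>
    have hz : 0 < z.re := by simpa using hk
    have hG : Complex.Gamma z ≠ 0 := Complex.Gamma_ne_zero_of_re_pos hz
    have h := (tendsto_const_nhds (x := Complex.Gamma z)).div
      (Complex.GammaSeq_tendsto_Gamma z) hG
    rw [div_self hG] at h
    refine h.congr fun n => ?_
    have hne : ∀ j : ℕ, z ≠ -j := fun j hj => by
      have := congrArg Complex.re hj
      simp only [Complex.neg_re, Complex.natCast_re] at this
      have : (0 : ℝ) ≤ j := j.cast_nonneg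
      linarith
    have hprod := Complex.Gamma_add_nat_div_Gamma_eq (n := n + 1) z hne
    rw [Pi.div_apply, Complex.GammaSeq,
      ← ascPochhammer_eval_eq_prod_range, ← hprod, add_assoc z]
    push_cast
    field_simp
  | succ k ih =>
    have h := ih (z + 1) (by simp at hk ⊢; linarith)
    have hq : Tendsto (fun n : ℕ => (n : ℂ) / (n + (z + 1))) atTop (𝓝 1) :=
      tendsto_natCast_div_add_atTop (z + 1)
    have hpos : ∀ᶠ n : ℕ in atTop, z + n + 1 ≠ 0 := by
      obtain ⟨K, hK⟩ := exists_nat_gt (-z.re)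
      filter_upwards [eventually_ge_atTop K] with n hn h0
      have := congrArg Complex.re h0
      have hn' : (K : ℝ) ≤ n := by exact_mod_cast hn
      simp at this
      linarith
    have h2 := h.mul hq
    rw [one_mul] at h2
    refine h2.congr' ?_
    filter_upwards [hpos, eventually_ne_atTop 0] with n hn hn0
    have hnC : (n : ℂ) ≠ 0 := Nat.cast_ne_zero.mpr hn0
    rw [show z + 1 + n + 1 = (z + n + 1) + 1 by ring, Complex.Gamma_add_one _ hn,
      Complex.cpow_add _ _ hnC, Complex.cpow_one, show (n : ℂ) + (z + 1) = z + n + 1 by ring]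
    have h3 : (n : ℂ) ^ z ≠ 0 := by simp [Complex.cpow_eq_zero_iff, hnC]
    have h4 : (n.factorial : ℂ) ≠ 0 := Nat.cast_ne_zero.mpr n.factorial_ne_zero
    field_simp

open Filter Topology in
/-- The asymptotics of the central multinomial coefficient `((N + 1) m)! / m! ^ (N + 1)`. -/
theorem tendsto_multinomial_stirling (N : ℕ) :
    Tendsto (fun m : ℕ => √(m : ℝ) ^ N * (((N + 1) * m).factorial : ℝ) /
        ((m.factorial : ℝ) ^ (N + 1) * ((N : ℝ) + 1) ^ ((N + 1) * m)))
      atTop (𝓝 ((2 * Real.pi) ^ (-(N : ℝ) / 2) * √((N : ℝ) + 1))) := by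
  have hsub : Tendsto (fun m : ℕ => (N + 1) * m) atTop atTop :=
    tendsto_id.const_mul_atTop' (Nat.succ_pos N)
  have hpi : √Real.pi ≠ 0 := (Real.sqrt_pos.mpr Real.pi_pos).ne'
  have h := ((Stirling.tendsto_stirlingSeq_sqrt_pi.comp hsub).div
    (Stirling.tendsto_stirlingSeq_sqrt_pi.pow (N + 1)) (pow_ne_zero _ hpi)).mul_const
      (√((N : ℝ) + 1) / √2 ^ N)
  have hlim : √Real.pi / √Real.pi ^ (N + 1) * (√((N : ℝ) + 1) / √2 ^ N) =
      (2 * Real.pi) ^ (-(N : ℝ) / 2) * √((N : ℝ) + 1) := by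
    have h2 : (2 * Real.pi) ^ (-(N : ℝ) / 2) = (√(2 * Real.pi) ^ N)⁻¹ := by
      rw [neg_div, Real.rpow_neg (by positivity), Real.sqrt_eq_rpow, ← Real.rpow_natCast,
        ← Real.rpow_mul (by positivity)]
      congr 2
      ring
    rw [h2, Real.sqrt_mul (by norm_num), mul_pow, pow_succ]
    field_simp
  rw [hlim] at h
  refine h.congr' ?_
  filter_upwards [eventually_gt_atTop 0] with m hm
  have hm' : (0 : ℝ) < m := by exact_mod_cast hm
  have hM : (0 : ℝ) < (N : ℝ) + 1 := by positivity
  simp only [Pi.div_apply, Function.comp_apply, Stirling.stirlingSeq]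
  push_cast
  rw [show (2 : ℝ) * (((N : ℝ) + 1) * m) = ((N : ℝ) + 1) * (2 * m) by ring,
    Real.sqrt_mul hM.le, Real.sqrt_mul (by norm_num : (0 : ℝ) ≤ 2), mul_div_assoc,
    mul_pow _ _ ((N + 1) * m)]
  simp only [div_pow, mul_pow, ← pow_mul, mul_comm m (N + 1)]
  have e1 : √((N : ℝ) + 1) ≠ 0 := (Real.sqrt_pos.mpr hM).ne'
  have e2 : √(m : ℝ) ≠ 0 := (Real.sqrt_pos.mpr hm').ne'
  have e3 : (m.factorial : ℝ) ≠ 0 := Nat.cast_ne_zero.mpr m.factorial_ne_zero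
  field_simp
  ring

theorem stmt17 (N : ℕ) (hN : 1 ≤ N) (δ : ℂ) (hδ : -1 < δ.re) :
    Filter.Tendsto (fun m : ℕ =>
      Complex.Gamma (1 + ((N : ℂ) + 1) * m + (N : ℂ) / 2 + ((N : ℂ) + 1) * δ) /
        (Complex.Gamma (1 + (m : ℂ) + δ) ^ (N + 1) *
          cpowR ((N : ℝ) + 1) (((N : ℂ) + 1) * m + (N : ℂ) / 2 + ((N : ℂ) + 1) * δ)))
      Filter.atTop
      (nhds ((((2 * Real.pi) ^ (-(N : ℝ) / 2) * Real.sqrt ((N : ℝ) + 1) : ℝ)) : ℂ)) := by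
  have hsub : Filter.Tendsto (fun m : ℕ => (N + 1) * m) Filter.atTop Filter.atTop :=
    Filter.tendsto_id.const_mul_atTop' (Nat.succ_pos N)
  have hnum := (tendsto_Gamma_add_nat_div ((N : ℂ) / 2 + ((N : ℂ) + 1) * δ)).comp hsub
  have hden := (tendsto_Gamma_add_nat_div δ).pow (N + 1)
  have hreal := (Complex.continuous_ofReal.tendsto _).comp (tendsto_multinomial_stirling N)
  have h := (hnum.div hden (by simp)).mul hreal
  rw [one_pow, div_one, one_mul] at h
  refine h.congr' ?_
  filter_upwards [Filter.eventually_gt_atTop 0] with m hm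
  have hmR : (0 : ℝ) < m := by exact_mod_cast hm
  have hmC : (m : ℂ) ≠ 0 := Nat.cast_ne_zero.mpr hm.ne'
  have hM : (0 : ℝ) < (N : ℝ) + 1 := by positivity
  have hMC : (N : ℂ) + 1 ≠ 0 := by exact_mod_cast Nat.succ_ne_zero N
  have hsqrt : ((√(m : ℝ) : ℝ) : ℂ) ^ N = (m : ℂ) ^ ((N : ℂ) / 2) := by
    rw [Real.sqrt_eq_rpow, Complex.ofReal_cpow hmR.le, ← Complex.cpow_nat_mul]
    push_cast
    congr 1
    ring
  have hcpowR : ∀ w : ℂ, cpowR ((N : ℝ) + 1) w = ((N : ℂ) + 1) ^ w := fun w => by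
    rw [cpowR, Complex.cpow_def_of_ne_zero hMC, Complex.ofReal_log hM.le, mul_comm]
    push_cast
    rfl
  have hbase : (((N + 1) * m : ℕ) : ℂ) ^ ((N : ℂ) / 2 + ((N : ℂ) + 1) * δ) =
      ((N : ℂ) + 1) ^ ((N : ℂ) / 2 + ((N : ℂ) + 1) * δ) *
        ((m : ℂ) ^ ((N : ℂ) / 2) * ((m : ℂ) ^ δ) ^ (N + 1)) := by
    rw [← Complex.cpow_nat_mul, Nat.cast_mul, Complex.natCast_mul_natCast_cpow,
      Complex.cpow_add (x := (m : ℂ)) _ _ hmC]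
    push_cast
    rfl
  have hsplit : ((N : ℂ) + 1) ^ (((N : ℂ) + 1) * m + (N : ℂ) / 2 + ((N : ℂ) + 1) * δ) =
      ((N : ℂ) + 1) ^ ((N + 1) * m) *
        ((N : ℂ) + 1) ^ ((N : ℂ) / 2 + ((N : ℂ) + 1) * δ) := by
    rw [add_assoc, Complex.cpow_add _ _ hMC, ← Complex.cpow_natCast]
    push_cast
    rfl
  simp only [Pi.div_apply, Function.comp_apply]
  rw [hcpowR, hsplit, hbase]
  push_cast
  rw [hsqrt, show (N : ℂ) / 2 + ((N : ℂ) + 1) * δ + ((N : ℂ) + 1) * m + 1 =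
    1 + ((N : ℂ) + 1) * m + (N : ℂ) / 2 + ((N : ℂ) + 1) * δ by ring,
    show δ + (m : ℂ) + 1 = 1 + m + δ by ring]
  have e1 : (m : ℂ) ^ ((N : ℂ) / 2) ≠ 0 := by simp [Complex.cpow_eq_zero_iff, hmC]
  have e2 : (m : ℂ) ^ δ ≠ 0 := by simp [Complex.cpow_eq_zero_iff, hmC]
  have e3 : ((N : ℂ) + 1) ^ ((N : ℂ) / 2 + ((N : ℂ) + 1) * δ) ≠ 0 := by
    simp [Complex.cpow_eq_zero_iff, hMC]
  have e4 : (m.factorial : ℂ) ≠ 0 := Nat.cast_ne_zero.mpr m.factorial_ne_zero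
  have e5 : ((((N + 1) * m).factorial : ℕ) : ℂ) ≠ 0 :=
    Nat.cast_ne_zero.mpr (Nat.factorial_ne_zero _)
  generalize ((N : ℂ) + 1) ^ ((N : ℂ) / 2 + ((N : ℂ) + 1) * δ) = A at *
  generalize (m : ℂ) ^ ((N : ℂ) / 2) = B at *
  generalize (m : ℂ) ^ δ = C at *
  simp only [div_pow, mul_pow]
  field_simp
end
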